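/- The assignment t_{i,j}^{(r)} ↦ (−1)^{|i|} e_{i,j} x^{r−1} defines an isomorphism of graded superalgebras from the associated graded algebra of the super Yangian Y_{m|n} with respect to the loop filtration onto the universal enveloping algebra U(gl_{m|n}[x]). -/

import Mathlib

def glPar (m : ℕ) {N : ℕ} (i : Fin N) : ℕ := if (i : ℕ) < m then 0 else 1

/-- t_{i,j}^{(r)} as element of the free algebra; t^{(0)} = δ_{i,j}, and t^{(r+1)}
is the generator indexed by (i,j,r). -/
noncomputable def tFree (k : Type*) [Field k] (m n : ℕ) (i j : Fin (m+n)) :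
    ℕ → FreeAlgebra k (Fin (m+n) × Fin (m+n) × ℕ)
  | 0 => if i = j then 1 else 0
  | r + 1 => FreeAlgebra.ι k (i, j, r)

/-- The RTT relations of the super Yangian Y_{m|n}:
[t_{i,j}^{(r)}, t_{k,l}^{(s)}] (supercommutator) =
(−1)^{|i||j|+|i||k|+|j||k|} Σ_{t=0}^{min(r,s)−1}
  (t_{k,j}^{(t)} t_{i,l}^{(r+s−1−t)} − t_{k,j}^{(r+s−1−t)} t_{i,l}^{(t)}). -/
inductive YRel (k : Type*) [Field k] (m n : ℕ) :
    FreeAlgebra k (Fin (m+n) × Fin (m+n) × ℕ) →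
    FreeAlgebra k (Fin (m+n) × Fin (m+n) × ℕ) → Prop
  | rel (i j kk l : Fin (m+n)) (r s : ℕ) :
      YRel k m n
        (tFree k m n i j (r+1) * tFree k m n kk l (s+1) -
          ((-1 : ℤ) ^ ((glPar m i + glPar m j) * (glPar m kk + glPar m l))) •
            (tFree k m n kk l (s+1) * tFree k m n i j (r+1)))
        (((-1 : ℤ) ^ (glPar m i * glPar m j + glPar m i * glPar m kk +
            glPar m j * glPar m kk)) •
          ∑ t ∈ Finset.range (min (r+1) (s+1)),
            (tFree k m n kk j t * tFree k m n i l (r+s+1-t) -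
              tFree k m n kk j (r+s+1-t) * tFree k m n i l t))

/-- The super Yangian Y_{m|n} over k, defined by the RTT presentation. -/
noncomputable abbrev Yangian (k : Type*) [Field k] (m n : ℕ) := RingQuot (YRel k m n)

/-- the RTT generators t_{i,j}^{(r)} of Y_{m|n}. -/
noncomputable def tY (k : Type*) [Field k] (m n : ℕ) (i j : Fin (m+n)) (r : ℕ) :
    Yangian k m n :=
  RingQuot.mkAlgHom k (YRel k m n) (tFree k m n i j r)


/-- The defining relations of U(gl_{m|n}[x]) (supercommutator = super bracket). -/
inductive URel (k : Type*) [Field k] (m n : ℕ) :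
    FreeAlgebra k (Fin (m+n) × Fin (m+n) × ℕ) →
    FreeAlgebra k (Fin (m+n) × Fin (m+n) × ℕ) → Prop
  | rel (a b : Fin (m+n) × Fin (m+n) × ℕ) :
      URel k m n
        (FreeAlgebra.ι k a * FreeAlgebra.ι k b -
          ((-1 : ℤ) ^ ((glPar m a.1 + glPar m a.2.1) * (glPar m b.1 + glPar m b.2.1))) •
            (FreeAlgebra.ι k b * FreeAlgebra.ι k a))
        ((if b.1 = a.2.1 then FreeAlgebra.ι k (a.1, b.2.1, a.2.2 + b.2.2) else 0) -
          ((-1 : ℤ) ^ ((glPar m a.1 + glPar m a.2.1) * (glPar m b.1 + glPar m b.2.1))) •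
            (if b.2.1 = a.1 then FreeAlgebra.ι k (b.1, a.2.1, a.2.2 + b.2.2) else 0))

/-- U(gl_{m|n}[x]). -/
noncomputable abbrev UEnv (k : Type*) [Field k] (m n : ℕ) := RingQuot (URel k m n)

/-- the image of the basis element e_{i,j}x^r in U(gl_{m|n}[x]). -/
noncomputable def EU (k : Type*) [Field k] (m n : ℕ) (a : Fin (m+n) × Fin (m+n) × ℕ) :
    UEnv k m n :=
  RingQuot.mkAlgHom k (URel k m n) (FreeAlgebra.ι k a)

/-- the loop filtration on Y_{m|n}: F_r is spanned by products of generators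
t_{i,j}^{(d+1)} (of degree d) with total degree ≤ r. -/
noncomputable def loopF (k : Type*) [Field k] (m n : ℕ) (r : ℕ) :
    Submodule k (Yangian k m n) :=
  Submodule.span k {y | ∃ l : List (Fin (m+n) × Fin (m+n) × ℕ),
    (l.map fun a => a.2.2).sum ≤ r ∧
    y = (l.map fun a => tY k m n a.1 a.2.1 (a.2.2 + 1)).prod}

/-- the grading of U(gl_{m|n}[x]) by total x-degree. -/
noncomputable def gradU (k : Type*) [Field k] (m n : ℕ) (r : ℕ) :
    Submodule k (UEnv k m n) :=
  Submodule.span k {x | ∃ l : List (Fin (m+n) × Fin (m+n) × ℕ),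
    (l.map fun a => a.2.2).sum = r ∧ x = (l.map (EU k m n)).prod}

namespace FreeAlgebra

variable {k : Type*} [Field k] {X : Type*}

/-- The monomial in the free algebra attached to a list of letters. -/
noncomputable def word (k : Type*) [Field k] {X : Type*} (l : List X) : FreeAlgebra k X :=
  (l.map (FreeAlgebra.ι k)).prod

@[simp] lemma word_nil : word k ([] : List X) = 1 := rfl

@[simp] lemma word_cons (x : X) (l : List X) : word k (x :: l) = ι k x * word k l := by
  simp [word]

lemma word_append (l l' : List X) : word k (l ++ l') = word k l * word k l' := by
  simp [word]

lemma span_range_word : Submodule.span k (Set.range (word k (X := X))) = ⊤ := by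
  refine eq_top_iff.2 fun f _ => ?_
  induction f using FreeAlgebra.induction with
  | grade0 r =>
    rw [Algebra.algebraMap_eq_smul_one]
    exact Submodule.smul_mem _ _ (Submodule.subset_span ⟨[], rfl⟩)
  | grade1 x => exact Submodule.subset_span ⟨[x], by simp⟩
  | mul a b ha hb =>
    have h := Submodule.mul_mem_mul (ha trivial) (hb trivial)
    rw [Submodule.span_mul_span] at h
    refine Submodule.span_mono ?_ h
    rintro _ ⟨_, ⟨l, rfl⟩, _, ⟨l', rfl⟩, rfl⟩
    exact ⟨l ++ l', word_append l l'⟩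
  | add a b ha hb => exact Submodule.add_mem _ (ha trivial) (hb trivial)

/-- The total weight of a word. -/
def weight (ω : X → ℕ) (l : List X) : ℕ := (l.map ω).sum

@[simp] lemma weight_nil (ω : X → ℕ) : weight ω [] = 0 := rfl

@[simp] lemma weight_cons (ω : X → ℕ) (x : X) (l : List X) :
    weight ω (x :: l) = ω x + weight ω l := by simp [weight]

@[simp] lemma weight_append (ω : X → ℕ) (l l' : List X) :
    weight ω (l ++ l') = weight ω l + weight ω l' := by simp [weight]

/-- The span of the words of weight less than `r`. -/
noncomputable def wordsLT (k : Type*) [Field k] {X : Type*} (ω : X → ℕ) (r : ℕ) :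
    Submodule k (FreeAlgebra k X) :=
  Submodule.span k {f | ∃ l, weight ω l < r ∧ f = word k l}

/-- The span of the words of weight `r`. -/
noncomputable def wordsEQ (k : Type*) [Field k] {X : Type*} (ω : X → ℕ) (r : ℕ) :
    Submodule k (FreeAlgebra k X) :=
  Submodule.span k {f | ∃ l, weight ω l = r ∧ f = word k l}

lemma word_mem_wordsLT {ω : X → ℕ} {r : ℕ} {l : List X} (h : weight ω l < r) :
    word k l ∈ wordsLT k ω r := Submodule.subset_span ⟨l, h, rfl⟩

lemma word_mem_wordsEQ (ω : X → ℕ) (l : List X) :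
    word k l ∈ wordsEQ k ω (weight ω l) := Submodule.subset_span ⟨l, rfl, rfl⟩

lemma wordsLT_zero (ω : X → ℕ) : wordsLT k ω 0 = ⊥ := by simp [wordsLT]

lemma word_mul_mem_wordsLT {ω : X → ℕ} {r : ℕ} (l l' : List X) {f : FreeAlgebra k X}
    (hf : f ∈ wordsLT k ω r) :
    word k l * f * word k l' ∈ wordsLT k ω (weight ω l + r + weight ω l') := by
  induction hf using Submodule.span_induction with
  | mem f hf =>
    obtain ⟨l₁, h, rfl⟩ := hf
    rw [← word_append, ← word_append]
    exact word_mem_wordsLT (by simp only [weight_append]; omega)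
  | zero => simp
  | add x y _ _ hx hy => rw [mul_add, add_mul]; exact Submodule.add_mem _ hx hy
  | smul a x _ hx =>
    rw [mul_smul_comm, smul_mul_assoc]; exact Submodule.smul_mem _ _ hx

lemma word_mul_mem_wordsEQ {ω : X → ℕ} {r : ℕ} (l l' : List X) {f : FreeAlgebra k X}
    (hf : f ∈ wordsEQ k ω r) :
    word k l * f * word k l' ∈ wordsEQ k ω (weight ω l + r + weight ω l') := by
  induction hf using Submodule.span_induction with
  | mem f hf =>
    obtain ⟨l₁, h, rfl⟩ := hf
    rw [← word_append, ← word_append]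
    exact Submodule.subset_span ⟨_, by simp only [weight_append]; omega, rfl⟩
  | zero => simp
  | add x y _ _ hx hy => rw [mul_add, add_mul]; exact Submodule.add_mem _ hx hy
  | smul a x _ hx =>
    rw [mul_smul_comm, smul_mul_assoc]; exact Submodule.smul_mem _ _ hx

/-- The algebra map recording the weight of a word as the exponent of a polynomial variable. -/
noncomputable def weightHom (k : Type*) [Field k] {X : Type*} (ω : X → ℕ) :
    FreeAlgebra k X →ₐ[k] Polynomial (FreeAlgebra k X) :=
  FreeAlgebra.lift k fun x => Polynomial.monomial (ω x) (ι k x)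

lemma weightHom_word (ω : X → ℕ) (l : List X) :
    weightHom k ω (word k l) = Polynomial.monomial (weight ω l) (word k l) := by
  induction l with
  | nil => simp
  | cons x l ih =>
    rw [word_cons, map_mul, ih, weight_cons, ← Polynomial.monomial_mul_monomial]
    simp [weightHom]

/-- Projection of the free algebra onto its component of weight `r`. -/
noncomputable def proj (k : Type*) [Field k] {X : Type*} (ω : X → ℕ) (r : ℕ) :
    FreeAlgebra k X →ₗ[k] FreeAlgebra k X :=
  (Polynomial.lcoeff (FreeAlgebra k X) r).restrictScalars k ∘ₗ (weightHom k ω).toLinearMap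

lemma proj_apply (ω : X → ℕ) (r : ℕ) (f : FreeAlgebra k X) :
    proj k ω r f = (weightHom k ω f).coeff r := rfl

lemma proj_word (ω : X → ℕ) (r : ℕ) (l : List X) :
    proj k ω r (word k l) = if weight ω l = r then word k l else 0 := by
  rw [proj_apply, weightHom_word, Polynomial.coeff_monomial]

lemma proj_of_mem_wordsEQ {ω : X → ℕ} {e : ℕ} (r : ℕ) {f : FreeAlgebra k X}
    (hf : f ∈ wordsEQ k ω e) : proj k ω r f = if e = r then f else 0 := by
  induction hf using Submodule.span_induction with
  | mem f hf => obtain ⟨l, rfl, rfl⟩ := hf; exact proj_word ω r l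
  | zero => simp
  | add x y _ _ hx hy => rw [map_add, hx, hy]; split_ifs <;> simp
  | smul a x _ hx => rw [map_smul, hx]; split_ifs <;> simp

lemma proj_mem_wordsEQ (ω : X → ℕ) (r : ℕ) (f : FreeAlgebra k X) :
    proj k ω r f ∈ wordsEQ k ω r := by
  have hf : f ∈ Submodule.span k (Set.range (word k (X := X))) := by
    rw [span_range_word]; trivial
  induction hf using Submodule.span_induction with
  | mem f hf =>
    obtain ⟨l, rfl⟩ := hf
    rw [proj_word]
    split_ifs with h
    · exact h ▸ word_mem_wordsEQ ω l
    · exact zero_mem _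
  | zero => simp
  | add x y _ _ hx hy => rw [map_add]; exact add_mem hx hy
  | smul a x _ hx => rw [map_smul]; exact Submodule.smul_mem _ _ hx

lemma proj_proj (ω : X → ℕ) (r : ℕ) (f : FreeAlgebra k X) :
    proj k ω r (proj k ω r f) = proj k ω r f := by
  rw [proj_of_mem_wordsEQ r (proj_mem_wordsEQ ω r f), if_pos rfl]

lemma sub_proj_mem_wordsLT {ω : X → ℕ} {r : ℕ} {f : FreeAlgebra k X}
    (hf : f ∈ wordsLT k ω (r + 1)) : f - proj k ω r f ∈ wordsLT k ω r := by
  induction hf using Submodule.span_induction with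
  | mem f hf =>
    obtain ⟨l, h, rfl⟩ := hf
    rw [proj_word]
    split_ifs with h'
    · simp
    · rw [sub_zero]; exact word_mem_wordsLT (by omega)
  | zero => simp
  | add x y _ _ hx hy => rw [map_add, add_sub_add_comm]; exact add_mem hx hy
  | smul a x _ hx => rw [map_smul, ← smul_sub]; exact Submodule.smul_mem _ _ hx

lemma proj_of_mem_wordsLT {ω : X → ℕ} {r : ℕ} {f : FreeAlgebra k X}
    (hf : f ∈ wordsLT k ω r) : proj k ω r f = 0 := by
  induction hf using Submodule.span_induction with
  | mem f hf => obtain ⟨l, h, rfl⟩ := hf; rw [proj_word, if_neg (by omega)]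
  | zero => simp
  | add x y _ _ hx hy => rw [map_add, hx, hy, add_zero]
  | smul a x _ hx => rw [map_smul, hx, smul_zero]

lemma wordsEQ_le_wordsLT (ω : X → ℕ) (r : ℕ) : wordsEQ k ω r ≤ wordsLT k ω (r + 1) :=
  Submodule.span_mono fun _ ⟨l, h, hf⟩ => ⟨l, by omega, hf⟩

/-- If a map `g` to polynomials has, on each letter, degree at most the weight of the letter and
leading coefficient `θ`, then its coefficient of degree `r` on words of weight at most `r` is given
by `θ` on the component of weight `r`. -/
lemma coeff_eq_of_leading {B : Type*} [Ring B] [Algebra k B] {ω : X → ℕ}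
    (g : FreeAlgebra k X →ₐ[k] Polynomial B) (θ : FreeAlgebra k X →ₐ[k] B)
    (hdeg : ∀ x, (g (ι k x)).natDegree ≤ ω x)
    (hcoeff : ∀ x, (g (ι k x)).coeff (ω x) = θ (ι k x))
    {r : ℕ} {f : FreeAlgebra k X} (hf : f ∈ wordsLT k ω (r + 1)) :
    (g f).coeff r = θ (proj k ω r f) := by
  have hword : ∀ l : List X, (g (word k l)).natDegree ≤ weight ω l ∧
      (g (word k l)).coeff (weight ω l) = θ (word k l) := by
    intro l
    induction l with
    | nil => simp
    | cons x l ih =>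
      simp only [word_cons, weight_cons, map_mul]
      exact ⟨Polynomial.natDegree_mul_le.trans (add_le_add (hdeg x) ih.1), by
        rw [Polynomial.coeff_mul_add_eq_of_natDegree_le (hdeg x) ih.1, hcoeff, ih.2]⟩
  induction hf using Submodule.span_induction with
  | mem f hf =>
    obtain ⟨l, h, rfl⟩ := hf
    rw [proj_word]
    split_ifs with h'
    · rw [← h', (hword l).2]
    · rw [map_zero]
      exact Polynomial.coeff_eq_zero_of_natDegree_lt ((hword l).1.trans_lt (by omega))
  | zero => simp
  | add x y _ _ hx hy => simp [hx, hy]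
  | smul a x _ hx => simp [hx]

lemma proj_mul {ω : X → ℕ} {r r' : ℕ} {f f' : FreeAlgebra k X}
    (hf : f ∈ wordsLT k ω (r + 1)) (hf' : f' ∈ wordsLT k ω (r' + 1)) :
    proj k ω (r + r') (f * f') = proj k ω r f * proj k ω r' f' := by
  have hdeg : ∀ {r} {f : FreeAlgebra k X}, f ∈ wordsLT k ω (r + 1) →
      (weightHom k ω f).natDegree ≤ r := by
    intro r f hf
    induction hf using Submodule.span_induction with
    | mem f hf =>
      obtain ⟨l, h, rfl⟩ := hf
      rw [weightHom_word]
      exact (Polynomial.natDegree_monomial_le _).trans (by omega)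
    | zero => simp
    | add x y _ _ hx hy =>
      rw [map_add]; exact Polynomial.natDegree_add_le_of_degree_le hx hy
    | smul a x _ hx => rw [map_smul]; exact (Polynomial.natDegree_smul_le _ _).trans hx
  simp only [proj_apply, map_mul]
  exact Polynomial.coeff_mul_add_eq_of_natDegree_le (hdeg hf) (hdeg hf')

lemma mul_mem_wordsLT {ω : X → ℕ} {r r' : ℕ} {f f' : FreeAlgebra k X}
    (hf : f ∈ wordsLT k ω (r + 1)) (hf' : f' ∈ wordsLT k ω (r' + 1)) :
    f * f' ∈ wordsLT k ω (r + r' + 1) := by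
  have h := Submodule.mul_mem_mul hf hf'
  rw [wordsLT, wordsLT, Submodule.span_mul_span] at h
  refine Submodule.span_mono ?_ h
  rintro _ ⟨_, ⟨l, hl, rfl⟩, _, ⟨l', hl', rfl⟩, rfl⟩
  exact ⟨l ++ l', by simp only [weight_append]; omega, (word_append l l').symm⟩

/-- An element of a free algebra killed in a quotient lies in every subspace that contains the
two-sided multiples of the relations. -/
lemma mem_of_mkAlgHom_eq_zero {rel : FreeAlgebra k X → FreeAlgebra k X → Prop}
    (M : Submodule k (FreeAlgebra k X))
    (hM : ∀ x y, rel x y → ∀ l l', word k l * (x - y) * word k l' ∈ M)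
    {f : FreeAlgebra k X} (hf : RingQuot.mkAlgHom k rel f = 0) : f ∈ M := by
  have hM' : ∀ x y, rel x y → ∀ a b, a * (x - y) * b ∈ M := by
    intro x y hxy a b
    have ha : a ∈ Submodule.span k (Set.range (word k (X := X))) := by
      rw [span_range_word]; trivial
    have hb : b ∈ Submodule.span k (Set.range (word k (X := X))) := by
      rw [span_range_word]; trivial
    induction ha using Submodule.span_induction with
    | mem a ha =>
      obtain ⟨l, rfl⟩ := ha
      induction hb using Submodule.span_induction with
      | mem b hb => obtain ⟨l', rfl⟩ := hb; exact hM x y hxy l l'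
      | zero => simp
      | add b c _ _ hb hc => rw [mul_add]; exact add_mem hb hc
      | smul t b _ hb => rw [mul_smul_comm]; exact Submodule.smul_mem _ _ hb
    | zero => simp
    | add a c _ _ ha hc => rw [add_mul, add_mul]; exact add_mem ha hc
    | smul t a _ ha => rw [smul_mul_assoc, smul_mul_assoc]; exact Submodule.smul_mem _ _ ha
  have hrel : ∀ x y, RingQuot.Rel rel x y → ∀ a b, a * (x - y) * b ∈ M := by
    intro x y h
    induction h with
    | of h => exact hM' _ _ h
    | add_left _ ih => intro a b; rw [add_sub_add_right_eq_sub]; exact ih a b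
    | mul_left _ ih =>
      rename_i x y z _
      intro a b
      rw [← sub_mul, ← mul_assoc, mul_assoc _ z b]
      exact ih a (z * b)
    | mul_right _ ih =>
      rename_i z x y _
      intro a b
      rw [← mul_sub, ← mul_assoc]
      exact ih (a * z) b
  have hgen : ∀ x y, Relation.EqvGen (RingQuot.Rel rel) x y → x - y ∈ M := by
    intro x y h
    induction h with
    | rel x y h => simpa using hrel x y h 1 1
    | refl => simp
    | symm x y _ ih => rw [← neg_sub]; exact neg_mem ih
    | trans x y z _ _ h₁ h₂ => rw [← sub_add_sub_cancel]; exact add_mem h₁ h₂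
  rw [← map_zero (RingQuot.mkAlgHom k rel), ← AlgHom.coe_toRingHom, RingQuot.mkAlgHom_coe] at hf
  simp only [RingQuot.mkRingHom_def] at hf
  have := hgen f 0 (Quot.eqvGen_exact (congrArg RingQuot.toQuot hf))
  rwa [sub_zero] at this

/-- If the homogeneous relations `rel` become of smaller weight under `π`, then so does every weight
component of an element killed by `rel`. -/
lemma proj_mem_of_mkAlgHom_eq_zero {rel : FreeAlgebra k X → FreeAlgebra k X → Prop}
    {B : Type*} [Ring B] [Algebra k B] (ω : X → ℕ) (π : FreeAlgebra k X →ₐ[k] B)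
    (h : ∀ x y, rel x y → ∃ e, x - y ∈ wordsEQ k ω e ∧
      π (x - y) ∈ (wordsLT k ω e).map π.toLinearMap)
    {f : FreeAlgebra k X} (hf : RingQuot.mkAlgHom k rel f = 0) (r : ℕ) :
    π (proj k ω r f) ∈ (wordsLT k ω r).map π.toLinearMap := by
  refine mem_of_mkAlgHom_eq_zero
    (((wordsLT k ω r).map π.toLinearMap).comap (π.toLinearMap ∘ₗ proj k ω r)) ?_ hf
  intro x y hxy l l'
  obtain ⟨e, he, g, hg, hgπ⟩ := h x y hxy
  rw [Submodule.mem_comap, LinearMap.comp_apply,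
    proj_of_mem_wordsEQ r (word_mul_mem_wordsEQ l l' he)]
  split_ifs with her
  · refine ⟨word k l * g * word k l', her ▸ word_mul_mem_wordsLT l l' hg, ?_⟩
    simp only [AlgHom.toLinearMap_apply, map_mul] at hgπ ⊢
    rw [hgπ]
  · simp

end FreeAlgebra

section SuperSigns

lemma glPar_eq_zero_or_one (m : ℕ) {N : ℕ} (i : Fin N) : glPar m i = 0 ∨ glPar m i = 1 := by
  unfold glPar; split_ifs <;> simp

/-- The sign produced by exchanging the matrix units indexed by `a` and `b`. -/
def superSign (k : Type*) [Field k] (m : ℕ) {N : ℕ} (a b : Fin N × Fin N × ℕ) : k :=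
  (-1) ^ ((glPar m a.1 + glPar m a.2.1) * (glPar m b.1 + glPar m b.2.1))

variable {k : Type*} [Field k] {m N : ℕ}

lemma superSign_comm (a b : Fin N × Fin N × ℕ) : superSign k m a b = superSign k m b a := by
  simp [superSign, mul_comm]

lemma superSign_mul_self (a b : Fin N × Fin N × ℕ) :
    superSign k m a b * superSign k m a b = 1 := by
  rw [superSign, ← mul_pow]; simp

lemma superSign_mul_right (a : Fin N × Fin N × ℕ) (i j l : Fin N) (r s t : ℕ) :
    superSign k m a (i, j, r) * superSign k m a (j, l, s) = superSign k m a (i, l, t) := by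
  simp only [superSign]
  rcases glPar_eq_zero_or_one m a.1 with h₁ | h₁ <;>
  rcases glPar_eq_zero_or_one m a.2.1 with h₂ | h₂ <;>
  rcases glPar_eq_zero_or_one m i with h₃ | h₃ <;>
  rcases glPar_eq_zero_or_one m j with h₄ | h₄ <;>
  rcases glPar_eq_zero_or_one m l with h₅ | h₅ <;>
  norm_num [h₁, h₂, h₃, h₄, h₅]

lemma superSign_eq_or (a b : Fin N × Fin N × ℕ) :
    superSign k m a b = 1 ∨ superSign k m a b = -1 := neg_one_pow_eq_or _ _

end SuperSigns

/-- The supercommutation relations among the matrix units `e_{i,j} x^r`. -/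
inductive SymRel (k : Type*) [Field k] (m n : ℕ) :
    FreeAlgebra k (Fin (m + n) × Fin (m + n) × ℕ) →
    FreeAlgebra k (Fin (m + n) × Fin (m + n) × ℕ) → Prop
  | rel (a b : Fin (m + n) × Fin (m + n) × ℕ) :
      SymRel k m n (FreeAlgebra.ι k a * FreeAlgebra.ι k b)
        (superSign k m a b • (FreeAlgebra.ι k b * FreeAlgebra.ι k a))

/-- The supersymmetric algebra on matrix units `e_{i,j} x^r`. -/
abbrev SuperSym (k : Type*) [Field k] (m n : ℕ) := RingQuot (SymRel k m n)

namespace SuperSym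

variable {k : Type*} [Field k] {m n : ℕ}

/-- The generators of the supersymmetric algebra. -/
noncomputable def gen (k : Type*) [Field k] {m n : ℕ} (a : Fin (m + n) × Fin (m + n) × ℕ) :
    SuperSym k m n :=
  RingQuot.mkAlgHom k (SymRel k m n) (FreeAlgebra.ι k a)

lemma gen_mul_gen (a b : Fin (m + n) × Fin (m + n) × ℕ) :
    gen k a * gen k b = superSign k m a b • (gen k b * gen k a) := by
  simpa [gen] using RingQuot.mkAlgHom_rel k (SymRel.rel (k := k) a b)

/-- The algebra map out of the supersymmetric algebra determined by its values on generators. -/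
noncomputable def lift {B : Type*} [Ring B] [Algebra k B]
    (φ : Fin (m + n) × Fin (m + n) × ℕ → B)
    (h : ∀ a b, φ a * φ b = superSign k m a b • (φ b * φ a)) : SuperSym k m n →ₐ[k] B :=
  RingQuot.liftAlgHom k ⟨FreeAlgebra.lift k φ, by rintro _ _ ⟨a, b⟩; simp [h a b]⟩

@[simp] lemma lift_gen {B : Type*} [Ring B] [Algebra k B]
    (φ : Fin (m + n) × Fin (m + n) × ℕ → B)
    (h : ∀ a b, φ a * φ b = superSign k m a b • (φ b * φ a))
    (a : Fin (m + n) × Fin (m + n) × ℕ) : lift φ h (gen k a) = φ a := by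
  simp [lift, gen]

lemma induction_gen {P : SuperSym k m n → Prop} (h1 : P 1) (hadd : ∀ s t, P s → P t → P (s + t))
    (hsmul : ∀ (c : k) s, P s → P (c • s)) (hgen : ∀ a s, P s → P (gen k a * s))
    (s : SuperSym k m n) : P s := by
  obtain ⟨f, rfl⟩ := RingQuot.mkAlgHom_surjective k (SymRel k m n) s
  have hf : f ∈ Submodule.span k (Set.range
      (FreeAlgebra.word k (X := Fin (m + n) × Fin (m + n) × ℕ))) := by
    rw [FreeAlgebra.span_range_word]; trivial
  have hz : P 0 := by simpa using hsmul 0 1 h1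
  induction hf using Submodule.span_induction with
  | mem f hf =>
    obtain ⟨l, rfl⟩ := hf
    induction l with
    | nil => simpa using h1
    | cons a l ih => simpa [gen] using hgen a _ ih
  | zero => simpa using hz
  | add x y _ _ hx hy => rw [map_add]; exact hadd _ _ hx hy
  | smul c x _ hx => rw [map_smul]; exact hsmul _ _ hx

/-- The product of matrix units attached to sites, zero if the sites are different. -/
noncomputable def siteMul (k : Type*) [Field k] {m n : ℕ}
    (a b : Fin (m + n) × Fin (m + n) × ℕ) : SuperSym k m n :=
  if b.1 = a.2.1 ∧ a.2.2 = b.2.2 then gen k (a.1, b.2.1, a.2.2) else 0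

lemma siteMul_mul_gen (a b c : Fin (m + n) × Fin (m + n) × ℕ) :
    siteMul k a b * gen k c =
      (superSign k m a c * superSign k m b c) • (gen k c * siteMul k a b) := by
  obtain ⟨i, j, r⟩ := a
  obtain ⟨i', j', r'⟩ := b
  simp only [siteMul]
  split_ifs with h
  · obtain ⟨rfl, rfl⟩ := h
    rw [gen_mul_gen, superSign_comm, superSign_comm _ c, superSign_comm _ c, superSign_mul_right]
  · simp

lemma gen_mul_siteMul (a b c : Fin (m + n) × Fin (m + n) × ℕ) :
    gen k c * siteMul k a b =
      (superSign k m c a * superSign k m c b) • (siteMul k a b * gen k c) := by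
  rw [siteMul_mul_gen, smul_smul, superSign_comm a c, superSign_comm b c, mul_mul_mul_comm,
    superSign_mul_self, superSign_mul_self]
  simp

/-- The triangular matrix encoding the superderivation that extends left multiplication by the
matrix unit `a`. -/
noncomputable def derMatrix (k : Type*) [Field k] {m n : ℕ}
    (a : Fin (m + n) × Fin (m + n) × ℕ) :
    SuperSym k m n →ₐ[k] Matrix (Fin 2) (Fin 2) (SuperSym k m n) :=
  lift (fun b => !![superSign k m a b • gen k b, siteMul k a b; 0, gen k b]) (by
    intro b c
    ext i j
    fin_cases i <;> fin_cases j
    · simp [Matrix.mul_apply, Fin.sum_univ_two, smul_smul, gen_mul_gen b c]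
      congr 1; ring
    · simp [Matrix.mul_apply, Fin.sum_univ_two]
      rw [siteMul_mul_gen a b c, gen_mul_siteMul a c b, smul_smul, ← mul_assoc,
        superSign_comm b a, superSign_mul_self, one_mul, smul_smul,
        mul_comm (superSign k m b c), add_comm]
    · simp [Matrix.mul_apply, Fin.sum_univ_two]
    · simp [Matrix.mul_apply, Fin.sum_univ_two, gen_mul_gen b c])

/-- The superderivation extending left multiplication by the matrix unit `a`. -/
noncomputable def der (k : Type*) [Field k] {m n : ℕ} (a : Fin (m + n) × Fin (m + n) × ℕ) :
    Module.End k (SuperSym k m n) where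
  toFun s := derMatrix k a s 0 1
  map_add' s t := by rw [map_add, Matrix.add_apply]
  map_smul' c s := by rw [map_smul, Matrix.smul_apply, RingHom.id_apply]

lemma derMatrix_gen (a b : Fin (m + n) × Fin (m + n) × ℕ) :
    derMatrix k a (gen k b) = !![superSign k m a b • gen k b, siteMul k a b; 0, gen k b] :=
  lift_gen _ _ b

lemma derMatrix_one_one (a : Fin (m + n) × Fin (m + n) × ℕ) (s : SuperSym k m n) :
    derMatrix k a s 1 1 = s := by
  induction s using induction_gen with
  | h1 => simp
  | hadd s t hs ht => simp [hs, ht]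
  | hsmul c s hs => simp [hs]
  | hgen b s hs => simp [derMatrix_gen, Matrix.mul_apply, Fin.sum_univ_two, hs]

@[simp] lemma der_one (a : Fin (m + n) × Fin (m + n) × ℕ) :
    der k a (1 : SuperSym k m n) = 0 := by
  simp [der]

lemma der_gen_mul (a b : Fin (m + n) × Fin (m + n) × ℕ) (s : SuperSym k m n) :
    der k a (gen k b * s) = superSign k m a b • (gen k b * der k a s) + siteMul k a b * s := by
  change derMatrix k a (gen k b * s) 0 1 =
    superSign k m a b • (gen k b * derMatrix k a s 0 1) + siteMul k a b * s
  rw [map_mul, derMatrix_gen, Matrix.mul_apply, Fin.sum_univ_two, derMatrix_one_one]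
  simp

/-- The action of the matrix unit `a` on the supersymmetric algebra: multiplication by `a` plus the
superderivation extending left multiplication by `a`. -/
noncomputable def act (k : Type*) [Field k] {m n : ℕ} (a : Fin (m + n) × Fin (m + n) × ℕ) :
    Module.End k (SuperSym k m n) :=
  LinearMap.mulLeft k (gen k a) + der k a

lemma act_apply (a : Fin (m + n) × Fin (m + n) × ℕ) (s : SuperSym k m n) :
    act k a s = gen k a * s + der k a s := rfl

@[simp] lemma act_one (a : Fin (m + n) × Fin (m + n) × ℕ) :
    act k a (1 : SuperSym k m n) = gen k a := by
  simp [act_apply]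

lemma act_gen_mul (a b : Fin (m + n) × Fin (m + n) × ℕ) (s : SuperSym k m n) :
    act k a (gen k b * s) = superSign k m a b • (gen k b * act k a s) + siteMul k a b * s := by
  rw [act_apply, der_gen_mul, act_apply, ← mul_assoc, gen_mul_gen, mul_add, smul_add,
    smul_mul_assoc, mul_assoc, add_assoc]

/-- The triple product of matrix units attached to sites. -/
noncomputable def siteMul₃ (k : Type*) [Field k] {m n : ℕ}
    (a b c : Fin (m + n) × Fin (m + n) × ℕ) : SuperSym k m n :=
  if (b.1 = a.2.1 ∧ a.2.2 = b.2.2) ∧ c.1 = b.2.1 ∧ b.2.2 = c.2.2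
  then gen k (a.1, c.2.1, a.2.2) else 0

lemma act_siteMul_mul (a b c : Fin (m + n) × Fin (m + n) × ℕ) (s : SuperSym k m n) :
    act k a (siteMul k b c * s) =
      (superSign k m a b * superSign k m a c) • (siteMul k b c * act k a s) +
        siteMul₃ k a b c * s := by
  obtain ⟨i, j, r⟩ := b
  obtain ⟨i', j', r'⟩ := c
  by_cases h : i' = j ∧ r = r'
  · obtain ⟨rfl, rfl⟩ := h
    simp only [siteMul, siteMul₃, and_self, if_true, and_true]
    rw [act_gen_mul, superSign_mul_right a i i' j' r r r]
    simp only [siteMul]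
  · simp [siteMul, siteMul₃, h]

/-- The action on the supersymmetric algebra satisfies the relations of the general linear Lie
superalgebra at each site, and operators at distinct sites supercommute. -/
lemma act_mul_act (a b : Fin (m + n) × Fin (m + n) × ℕ) :
    act k a * act k b - superSign k m a b • (act k b * act k a) =
      (if b.1 = a.2.1 ∧ a.2.2 = b.2.2 then act k (a.1, b.2.1, a.2.2) else 0) -
        superSign k m a b •
          (if a.1 = b.2.1 ∧ b.2.2 = a.2.2 then act k (b.1, a.2.1, b.2.2) else 0) := by
  have hbr : ∀ (a b c : Fin (m + n) × Fin (m + n) × ℕ) (s : SuperSym k m n),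
      (if b.1 = a.2.1 ∧ a.2.2 = b.2.2 then act k (a.1, b.2.1, a.2.2) else 0) (gen k c * s) =
        (superSign k m a c * superSign k m b c) • (gen k c *
          (if b.1 = a.2.1 ∧ a.2.2 = b.2.2 then act k (a.1, b.2.1, a.2.2) else 0) s) +
          siteMul₃ k a b c * s := by
    rintro ⟨i, j, r⟩ ⟨i', j', r'⟩ c s
    by_cases h : i' = j ∧ r = r'
    · obtain ⟨rfl, rfl⟩ := h
      simp only [siteMul₃, and_self, if_true, true_and]
      rw [act_gen_mul, superSign_comm _ c, superSign_comm _ c, superSign_comm _ c,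
        superSign_mul_right c i i' j' r r r]
      simp only [siteMul]
    · simp [siteMul₃, h]
  ext s
  induction s using induction_gen with
  | h1 =>
    have h : ∀ a b : Fin (m + n) × Fin (m + n) × ℕ, act k a (gen k b) =
        superSign k m a b • (gen k b * gen k a) + siteMul k a b := by
      intro a b; simpa using act_gen_mul a b (1 : SuperSym k m n)
    have h' : ∀ a b : Fin (m + n) × Fin (m + n) × ℕ,
        (if b.1 = a.2.1 ∧ a.2.2 = b.2.2 then act k (a.1, b.2.1, a.2.2) else 0) 1 =
          siteMul k a b := by
      intro a b; rw [siteMul]; split_ifs <;> simp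
    simp only [LinearMap.sub_apply, LinearMap.smul_apply, Module.End.mul_apply, h', act_one, h,
      gen_mul_gen a b, smul_add]
    rw [superSign_comm b a]
    rcases superSign_eq_or (k := k) (m := m) a b with hab | hab <;> rw [hab] <;> module
  | hadd s t hs ht => rw [map_add, map_add, hs, ht]
  | hsmul c s hs => rw [map_smul, map_smul, hs]
  | hgen c s hs =>
    simp only [LinearMap.sub_apply, LinearMap.smul_apply, Module.End.mul_apply] at hs ⊢
    rw [hbr, hbr, act_gen_mul, act_gen_mul, map_add, map_add, map_smul, map_smul, act_gen_mul,
      act_gen_mul, act_siteMul_mul, act_siteMul_mul]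
    have hs' := congrArg (fun t => gen k c * t) hs
    simp only [mul_sub, mul_smul_comm] at hs'
    rw [superSign_comm b a]
    rcases superSign_eq_or (k := k) (m := m) a b with hab | hab <;> rw [hab] at hs' ⊢ <;>
    linear_combination (norm := module) (superSign k m a c * superSign k m b c) • hs'

end SuperSym

section RTT

/-- The sign `(-1)^{|i||j|+|i||k|+|j||k|}`. -/
def rttSign {I : Type*} (par : I → ℕ) (i j k : I) : ℤ :=
  (-1) ^ (par i * par j + par i * par k + par j * par k)

/-- The sign `(-1)^{(|i|+|j|)(|k|+|l|)}`. -/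
def swapSign {I : Type*} (par : I → ℕ) (i j k l : I) : ℤ :=
  (-1) ^ ((par i + par j) * (par k + par l))

lemma neg_one_pow_eq_of_add {a b t : ℕ} (h : a + b = 2 * t) : (-1 : ℤ) ^ a = (-1) ^ b :=
  neg_one_pow_congr (Nat.even_add.1 ⟨t, by omega⟩)

/-- The RTT relation is stable under products of matrices with mutually supercommuting entries. -/
lemma rtt_mul_aux {K R I : Type*} [CommRing K] [Ring R] [Module K R] [IsScalarTower K R R]
    [SMulCommClass K R R] {par : I → ℕ}
    {c d : K} {a b a' b' : I → I → R}
    (h : ∀ i j k l, c • (a i j * b k l - swapSign par i j k l • (b k l * a i j)) =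
      rttSign par i j k • d • (a k j * b i l - b k j * a i l))
    (h' : ∀ i j k l, c • (a' i j * b' k l - swapSign par i j k l • (b' k l * a' i j)) =
      rttSign par i j k • d • (a' k j * b' i l - b' k j * a' i l))
    (hab : ∀ i j k l, a' i j * b k l = swapSign par i j k l • (b k l * a' i j))
    (hba : ∀ i j k l, b' i j * a k l = swapSign par i j k l • (a k l * b' i j))
    (i j k l p q : I) :
    c • ((a i p * a' p j) * (b k q * b' q l) -
        swapSign par i j k l • ((b k q * b' q l) * (a i p * a' p j))) =
      rttSign par i j k • d • ((a k p * a' p j) * (b i q * b' q l) -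
        (b k q * b' q j) * (a i p * a' p l)) +
      ((swapSign par q j k p * rttSign par i q k) • d • (b k q * a i p * (a' q j * b' p l)) -
        (swapSign par p j k q * rttSign par i p k) • d • (b k p * a i q * (a' p j * b' q l))) := by
  have H := congrArg (fun t => swapSign par p j k q • (t * (a' p j * b' q l))) (h i p k q)
  have H' := congrArg (fun t => (swapSign par p j k q * swapSign par i p k q) • (b k q * a i p * t))
    (h' p j q l)
  have hab' : ∀ i j k l x,
      a' i j * (b k l * x) = swapSign par i j k l • (b k l * (a' i j * x)) := by
    intro i j k l x; rw [← mul_assoc, hab, smul_mul_assoc, mul_assoc]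
  have hba' : ∀ i j k l x,
      b' i j * (a k l * x) = swapSign par i j k l • (a k l * (b' i j * x)) := by
    intro i j k l x; rw [← mul_assoc, hba, smul_mul_assoc, mul_assoc]
  simp only [mul_assoc, smul_mul_assoc, mul_smul_comm, mul_sub, sub_mul, smul_sub, hab', hba']
    at H H' ⊢
  have z₁ : swapSign par p j k q * swapSign par i p k q * swapSign par p j q l =
      swapSign par i j k l * swapSign par q l i p := by
    simp only [swapSign, ← pow_add]
    exact neg_one_pow_eq_of_add
      (t := par i * par k + par i * par l + par i * par q + par j * par k + par j * par l +
        par j * par q + par k * par p + par l * par p + 2 * par p * par q) (by ring)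
  have z₂ : swapSign par p j k q * rttSign par i p k =
      rttSign par i j k * swapSign par p j i q := by
    simp only [swapSign, rttSign, ← pow_add]
    exact neg_one_pow_eq_of_add
      (t := par i * par j + par i * par k + par i * par p + par j * par k + par j * par q +
        par k * par p + par p * par q) (by ring)
  have z₃ : swapSign par p j k q * swapSign par i p k q * rttSign par p j q =
      swapSign par q j k p * rttSign par i q k := by
    simp only [swapSign, rttSign, ← pow_add]
    exact neg_one_pow_eq_of_add
      (t := par i * par k + par i * par q + par j * par k + par j * par p + par j * par q +
        par k * par p + par k * par q + 2 * par p * par q) (by ring)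
  have z₄ : swapSign par p j k q * swapSign par i p k q * rttSign par p j q =
      rttSign par i j k * swapSign par q j i p := by
    simp only [swapSign, rttSign, ← pow_add]
    exact neg_one_pow_eq_of_add
      (t := par i * par j + par i * par k + par i * par q + par j * par k + par j * par p +
        par j * par q + par k * par p + 2 * par p * par q) (by ring)
  have y₁ := congrArg (fun t : ℤ => t • c • (b k q * (a i p * (b' q l * a' p j)))) z₁
  have y₂ := congrArg (fun t : ℤ => t • d • (a k p * (b i q * (a' p j * b' q l)))) z₂
  have y₃ := congrArg (fun t : ℤ => t • d • (b k q * (a i p * (a' q j * b' p l)))) z₃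
  have y₄ := congrArg (fun t : ℤ => t • d • (b k q * (a i p * (b' q j * a' p l)))) z₄
  linear_combination (norm := module) H + H' + y₁ + y₂ + y₃ - y₄

lemma rtt_mul {K R I : Type*} [Fintype I] [CommRing K] [Ring R] [Module K R] [IsScalarTower K R R]
    [SMulCommClass K R R] {par : I → ℕ}
    {c d : K} {a b a' b' : I → I → R}
    (h : ∀ i j k l, c • (a i j * b k l - swapSign par i j k l • (b k l * a i j)) =
      rttSign par i j k • d • (a k j * b i l - b k j * a i l))
    (h' : ∀ i j k l, c • (a' i j * b' k l - swapSign par i j k l • (b' k l * a' i j)) =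
      rttSign par i j k • d • (a' k j * b' i l - b' k j * a' i l))
    (hab : ∀ i j k l, a' i j * b k l = swapSign par i j k l • (b k l * a' i j))
    (hba : ∀ i j k l, b' i j * a k l = swapSign par i j k l • (a k l * b' i j))
    (i j k l : I) :
    c • ((∑ p, a i p * a' p j) * (∑ q, b k q * b' q l) -
        swapSign par i j k l • ((∑ q, b k q * b' q l) * (∑ p, a i p * a' p j))) =
      rttSign par i j k • d • ((∑ p, a k p * a' p j) * (∑ q, b i q * b' q l) -
        (∑ q, b k q * b' q j) * (∑ p, a i p * a' p l)) := by
  have hsum : ∀ f g : I → R, (∑ q, g q) * (∑ p, f p) = ∑ p, ∑ q, g q * f p := by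
    intro f g; rw [Finset.sum_mul_sum, Finset.sum_comm]
  rw [hsum (fun p => a i p * a' p j), hsum (fun p => a i p * a' p l), Finset.sum_mul_sum,
    Finset.sum_mul_sum]
  simp only [Finset.smul_sum, ← Finset.sum_sub_distrib]
  simp only [rtt_mul_aux h h' hab hba, Finset.sum_add_distrib, Finset.sum_sub_distrib]
  rw [Finset.sum_comm (f := fun p q => (swapSign par q j k p * rttSign par i q k) • d •
    (b k q * a i p * (a' q j * b' p l))), sub_self, add_zero]

open PowerSeries in
/-- The difference of the two formal variables, as a central element. -/
noncomputable def rttDiff (A : Type*) [Ring A] : Subring.center A⟦X⟧⟦X⟧ :=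
  ⟨X - C X, Subring.mem_center_iff.2 fun g => by
    rw [mul_sub, sub_mul, (commute_X g).eq]
    congr 1
    ext s : 1
    rw [coeff_mul_C, coeff_C_mul, (commute_X _).eq]⟩

open PowerSeries in
/-- The product of the two formal variables, as a central element. -/
noncomputable def rttProd (A : Type*) [Ring A] : Subring.center A⟦X⟧⟦X⟧ :=
  ⟨C X * X, Subring.mem_center_iff.2 fun g => by
    ext s : 1
    rw [← mul_assoc, (commute_X _).eq, (commute_X _).eq]
    cases s with
    | zero => simp
    | succ s => rw [coeff_succ_X_mul, mul_assoc, coeff_succ_X_mul, coeff_mul_C, coeff_C_mul,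
        (commute_X _).eq]⟩

open PowerSeries in
/-- The RTT relation for a matrix of power series, as an identity of series in two variables. -/
def IsRTT {A I : Type*} [Ring A] (par : I → ℕ) (t : I → I → A⟦X⟧) : Prop :=
  ∀ i j k l, rttDiff A • (C (t i j) * map C (t k l) -
      swapSign par i j k l • (map C (t k l) * C (t i j))) =
    rttSign par i j k • rttProd A • (C (t k j) * map C (t i l) - map C (t k j) * C (t i l))

section IsRTT

open PowerSeries

variable {A I : Type*} [Ring A] {par : I → ℕ} {t u : I → I → A⟦X⟧}

lemma coeff_coeff_C_mul_map (f g : A⟦X⟧) (r s : ℕ) :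
    coeff r (coeff s (C f * map C g)) = coeff r f * coeff s g := by
  rw [coeff_C_mul, coeff_map, coeff_mul_C]

lemma coeff_coeff_map_mul_C (f g : A⟦X⟧) (r s : ℕ) :
    coeff r (coeff s (map C g * C f)) = coeff s g * coeff r f := by
  rw [coeff_mul_C, coeff_map, coeff_C_mul]

lemma IsRTT.mul [Fintype I] (ht : IsRTT par t) (hu : IsRTT par u)
    (h : ∀ i j k l r s, coeff r (u i j) * coeff s (t k l) =
      swapSign par i j k l • (coeff s (t k l) * coeff r (u i j))) :
    IsRTT par fun i j => ∑ p, t i p * u p j := by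
  intro i j k l
  simp only [map_sum, map_mul]
  refine rtt_mul (a := fun i j => C (t i j)) (b := fun i j => map C (t i j))
    (a' := fun i j => C (u i j)) (b' := fun i j => map C (u i j)) ht hu ?_ ?_ i j k l
  · intro i j k l
    ext s r
    rw [map_zsmul, map_zsmul, coeff_coeff_C_mul_map, coeff_coeff_map_mul_C, h]
  · intro i j k l
    ext s r
    rw [map_zsmul, map_zsmul, coeff_coeff_C_mul_map, coeff_coeff_map_mul_C, h]

lemma coeff_coeff_rttDiff (x : A⟦X⟧⟦X⟧) (r s : ℕ) :
    coeff (r + 1) (coeff (s + 1) (rttDiff A • x)) =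
      coeff (r + 1) (coeff s x) - coeff r (coeff (s + 1) x) := by
  change coeff (r + 1) (coeff (s + 1) ((X - C X) * x)) = _
  rw [sub_mul, map_sub, map_sub, coeff_succ_X_mul, coeff_C_mul, coeff_succ_X_mul]

lemma coeff_coeff_rttProd (x : A⟦X⟧⟦X⟧) (r s : ℕ) :
    coeff (r + 1) (coeff (s + 1) (rttProd A • x)) = coeff r (coeff s x) := by
  change coeff (r + 1) (coeff (s + 1) (C X * X * x)) = _
  rw [mul_assoc, coeff_C_mul, coeff_succ_X_mul, coeff_succ_X_mul]

/-- The supercommutator of coefficients of `t`. -/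
noncomputable def rttBracket (par : I → ℕ) (t : I → I → A⟦X⟧) (i j k l : I) (r s : ℕ) : A :=
  coeff r (t i j) * coeff s (t k l) -
    swapSign par i j k l • (coeff s (t k l) * coeff r (t i j))

/-- A summand of the right-hand side of the RTT relation. -/
noncomputable def rttTerm (t : I → I → A⟦X⟧) (i j k l : I) (r s : ℕ) : A :=
  coeff r (t k j) * coeff s (t i l) - coeff s (t k j) * coeff r (t i l)

lemma coeff_coeff_bracket (i j k l : I) (r s : ℕ) :
    coeff r (coeff s (C (t i j) * map C (t k l) -
      swapSign par i j k l • (map C (t k l) * C (t i j)))) = rttBracket par t i j k l r s := by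
  rw [map_sub, map_sub, map_zsmul, map_zsmul, coeff_coeff_C_mul_map, coeff_coeff_map_mul_C]
  rfl

lemma coeff_coeff_term (i j k l : I) (r s : ℕ) :
    coeff r (coeff s (C (t k j) * map C (t i l) - map C (t k j) * C (t i l))) =
      rttTerm t i j k l r s := by
  rw [map_sub, map_sub, coeff_coeff_C_mul_map, coeff_coeff_map_mul_C]
  rfl

lemma IsRTT.bracket_succ (ht : IsRTT par t) (i j k l : I) (r s : ℕ) :
    rttBracket par t i j k l (r + 1) s - rttBracket par t i j k l r (s + 1) =
      rttSign par i j k • rttTerm t i j k l r s := by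
  have h := congrArg (fun x => coeff (r + 1) (coeff (s + 1) x)) (ht i j k l)
  simp only [map_zsmul] at h
  rwa [coeff_coeff_rttDiff, coeff_coeff_rttProd, coeff_coeff_bracket, coeff_coeff_bracket,
    coeff_coeff_term] at h

lemma isRTT_of_bracket_succ (h₀ : ∀ i j k l s, rttBracket par t i j k l 0 s = 0)
    (h₀' : ∀ i j k l r, rttBracket par t i j k l r 0 = 0)
    (h : ∀ i j k l r s, rttBracket par t i j k l (r + 1) s - rttBracket par t i j k l r (s + 1) =
      rttSign par i j k • rttTerm t i j k l r s) : IsRTT par t := by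
  intro i j k l
  have hd : ∀ x, (rttDiff A • x : A⟦X⟧⟦X⟧) = (X - C X) * x := fun _ => rfl
  have hp : ∀ x, (rttProd A • x : A⟦X⟧⟦X⟧) = C X * X * x := fun _ => rfl
  ext s r
  rw [map_zsmul, map_zsmul]
  cases s with
  | zero =>
    rw [hd, hp, sub_mul, map_sub, coeff_zero_X_mul, coeff_C_mul, mul_assoc, coeff_C_mul,
      coeff_zero_X_mul]
    cases r with
    | zero => simp
    | succ r => rw [zero_sub, map_neg, coeff_succ_X_mul, coeff_coeff_bracket, h₀']; simp
  | succ s =>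
    cases r with
    | zero =>
      rw [hd, hp, sub_mul, map_sub, coeff_succ_X_mul, coeff_C_mul, mul_assoc, coeff_C_mul,
        map_sub, coeff_coeff_bracket, h₀]
      simp
    | succ r =>
      rw [coeff_coeff_rttDiff, coeff_coeff_rttProd, coeff_coeff_bracket, coeff_coeff_bracket,
        coeff_coeff_term, h]

lemma rttBracket_zero_left [DecidableEq I] (h : ∀ i j, coeff 0 (t i j) = if i = j then 1 else 0)
    (i j k l : I) (s : ℕ) : rttBracket par t i j k l 0 s = 0 := by
  rw [rttBracket, h]
  split_ifs with hij
  · subst hij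
    rw [swapSign, ← two_mul, mul_assoc, pow_mul]; simp
  · simp

lemma rttBracket_zero_right [DecidableEq I] (h : ∀ i j, coeff 0 (t i j) = if i = j then 1 else 0)
    (i j k l : I) (r : ℕ) : rttBracket par t i j k l r 0 = 0 := by
  rw [rttBracket, h]
  split_ifs with hkl
  · subst hkl
    rw [swapSign, ← two_mul, mul_left_comm, pow_mul]; simp
  · simp

lemma IsRTT.bracket_eq_sum [DecidableEq I] (ht : IsRTT par t)
    (h : ∀ i j, coeff 0 (t i j) = if i = j then 1 else 0) (i j k l : I) (r s : ℕ) :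
    rttBracket par t i j k l r s =
      rttSign par i j k • ∑ q ∈ Finset.range (min r s), rttTerm t i j k l q (r + s - 1 - q) := by
  have hl : ∀ r s, rttBracket par t i j k l r s =
      rttSign par i j k • ∑ q ∈ Finset.range r, rttTerm t i j k l q (r + s - 1 - q) := by
    intro r
    induction r with
    | zero => intro s; simp [rttBracket_zero_left h]
    | succ r ih =>
      intro s
      rw [sub_eq_iff_eq_add.1 (ht.bracket_succ i j k l r s), ih, Finset.sum_range_succ, smul_add,
        add_comm]
      refine congrArg₂ _ (congrArg _ (Finset.sum_congr rfl fun q _ => ?_)) ?_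
      · congr 1; omega
      · congr 2; omega
  have hr : ∀ s r, rttBracket par t i j k l r s =
      rttSign par i j k • ∑ q ∈ Finset.range s, rttTerm t i j k l q (r + s - 1 - q) := by
    intro s
    induction s with
    | zero => intro r; simp [rttBracket_zero_right h]
    | succ s ih =>
      intro r
      have h' := ht.bracket_succ i j k l r s
      rw [sub_eq_iff_eq_add, ← sub_eq_iff_eq_add'] at h'
      rw [← h', ih, Finset.sum_range_succ, smul_add, sub_eq_add_neg, ← smul_neg]
      refine congrArg₂ _ (congrArg _ (Finset.sum_congr rfl fun q _ => ?_)) (congrArg _ ?_)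
      · congr 1; omega
      · rw [show r + (s + 1) - 1 - s = r by omega, rttTerm, rttTerm, neg_sub]
  rcases le_total r s with hrs | hrs
  · rw [min_eq_left hrs, hl]
  · rw [min_eq_right hrs, hr]

end IsRTT

end RTT

section Transfer

open PowerSeries

variable {k : Type*} [Field k] {m N : ℕ}

lemma swapSign_self_left {I : Type*} (par : I → ℕ) (i k l : I) : swapSign par i i k l = 1 := by
  rw [swapSign, ← two_mul, mul_assoc, pow_mul]; simp

lemma swapSign_self_right {I : Type*} (par : I → ℕ) (i j k : I) : swapSign par i j k k = 1 := by
  rw [swapSign, ← two_mul, mul_left_comm, pow_mul]; simp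

lemma swapSign_mul_right {I : Type*} (par : I → ℕ) (i j k q l : I) :
    swapSign par i j k q * swapSign par i j q l = swapSign par i j k l := by
  simp only [swapSign, ← pow_add]
  exact neg_one_pow_eq_of_add (t := (par i + par j) * (par k + par q + par l)) (by ring)

lemma swapSign_smul {V : Type*} [AddCommGroup V] [Module k V]
    (i j i' j' : Fin N) (r s : ℕ) (v : V) :
    swapSign (glPar m) i j i' j' • v = superSign k m (i, j, r) (i', j', s) • v := by
  rw [← Int.cast_smul_eq_zsmul k, swapSign, superSign]; simp

/-- The operators `e a` at each site satisfy the relations of the general linear Lie superalgebra,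
and operators at distinct sites supercommute. -/
def IsSiteRep {E : Type*} [Ring E] [Algebra k E] (m : ℕ) (e : Fin N × Fin N × ℕ → E) : Prop :=
  ∀ a b, e a * e b - superSign k m a b • (e b * e a) =
    (if b.1 = a.2.1 ∧ a.2.2 = b.2.2 then e (a.1, b.2.1, a.2.2) else 0) -
      superSign k m a b • (if a.1 = b.2.1 ∧ b.2.2 = a.2.2 then e (b.1, a.2.1, b.2.2) else 0)

variable {E : Type*} [Ring E] [Algebra k E] {e : Fin N × Fin N × ℕ → E}

/-- The matrix of series attached to the site `a` with spectral parameter `c`. -/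
noncomputable def siteL (m : ℕ) (e : Fin N × Fin N × ℕ → E) (c : k) (a : ℕ) (i j : Fin N) :
    PowerSeries (Polynomial E) :=
  PowerSeries.mk fun
    | 0 => if i = j then 1 else 0
    | r + 1 => Polynomial.monomial r (((-1) ^ glPar m i * c ^ r) • e (i, j, a))

lemma coeff_zero_siteL (c : k) (a : ℕ) (i j : Fin N) :
    coeff 0 (siteL m e c a i j) = if i = j then 1 else 0 := by
  simp [siteL]

lemma coeff_succ_siteL (c : k) (a : ℕ) (i j : Fin N) (r : ℕ) :
    coeff (r + 1) (siteL m e c a i j) =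
      Polynomial.monomial r (((-1) ^ glPar m i * c ^ r) • e (i, j, a)) := by
  simp [siteL]

lemma rttBracket_siteL (he : IsSiteRep (k := k) m e) (c : k) (a : ℕ) (i j i' j' : Fin N) (r s : ℕ) :
    rttBracket (glPar m) (siteL m e c a) i j i' j' (r + 1) (s + 1) =
      rttSign (glPar m) i j i' •
        ((if i' = j then coeff (r + s + 1) (siteL m e c a i j') else 0) -
          if i = j' then coeff (r + s + 1) (siteL m e c a i' j) else 0) := by
  have h := he (i, j, a) (i', j', a)
  rw [rttBracket, swapSign_smul (k := k) _ _ _ _ a a]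
  simp only [coeff_succ_siteL, Polynomial.monomial_mul_monomial]
  rw [add_comm s r, Polynomial.smul_monomial, ← map_sub]
  have h1 : ((-1 : k) ^ glPar m i * c ^ r) • e (i, j, a) *
      ((-1 : k) ^ glPar m i' * c ^ s) • e (i', j', a) -
      superSign k m (i, j, a) (i', j', a) • (((-1 : k) ^ glPar m i' * c ^ s) • e (i', j', a) *
      ((-1 : k) ^ glPar m i * c ^ r) • e (i, j, a)) =
      ((-1 : k) ^ glPar m i * (-1 : k) ^ glPar m i' * c ^ (r + s)) •
      (e (i, j, a) * e (i', j', a) -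
        superSign k m (i, j, a) (i', j', a) • (e (i', j', a) * e (i, j, a))) := by
    simp only [smul_mul_assoc, mul_smul_comm, pow_add]
    module
  rw [h1, h]
  have h2 : ∀ x : Polynomial E, rttSign (glPar m) i j i' • x =
      ((-1 : k) ^ (glPar m i * glPar m j + glPar m i * glPar m i' +
        glPar m j * glPar m i')) • x := by
    intro x
    rw [← Int.cast_smul_eq_zsmul k, rttSign]; simp
  rw [h2, smul_sub, map_sub, smul_sub]
  have hmon : ∀ (x : k) (f : E) (r : ℕ),
    x • Polynomial.monomial r f = Polynomial.monomial r (x • f) := fun x f r =>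
      Polynomial.smul_monomial x r f
  congr 1
  · simp only [and_true]
    split_ifs with hj
    · subst hj
      rw [hmon, smul_smul]
      congr 2
      rcases glPar_eq_zero_or_one m i with h₁ | h₁ <;>
      rcases glPar_eq_zero_or_one m i' with h₂ | h₂ <;> norm_num [h₁, h₂]
    · simp
  · simp only [and_true]
    split_ifs with hj
    · subst hj
      rw [hmon, smul_smul, smul_smul]
      congr 2
      rcases glPar_eq_zero_or_one m i with h₁ | h₁ <;>
      rcases glPar_eq_zero_or_one m j with h₃ | h₃ <;>
      rcases glPar_eq_zero_or_one m i' with h₂ | h₂ <;> norm_num [superSign, h₁, h₂, h₃]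
    · simp

lemma isRTT_siteL (he : IsSiteRep (k := k) m e) (c : k) (a : ℕ) :
    IsRTT (glPar m) (siteL m e c a) := by
  have h0 := rttBracket_zero_left (par := glPar m) (coeff_zero_siteL (e := e) (m := m) c a)
  have h0' := rttBracket_zero_right (par := glPar m) (coeff_zero_siteL (e := e) (m := m) c a)
  refine isRTT_of_bracket_succ h0 h0' ?_
  intro i j i' j' r s
  rcases r with _ | r <;> rcases s with _ | s
  · rw [h0, h0']; simp [rttTerm]
  · rw [h0, sub_zero, rttBracket_siteL he, rttTerm]
    simp only [coeff_zero_siteL, zero_add]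
    congr 2 <;> simp
  · rw [h0', zero_sub, rttBracket_siteL he, rttTerm, ← smul_neg, neg_sub]
    simp only [coeff_zero_siteL, add_zero]
    congr 2 <;> simp
  · rw [rttBracket_siteL he, rttBracket_siteL he, rttTerm,
      show r + 1 + s + 1 = r + (s + 1) + 1 by omega, sub_self]
    simp only [coeff_succ_siteL, Polynomial.monomial_mul_monomial, smul_mul_smul_comm]
    rw [add_comm s r, ← map_sub, ← sub_smul]
    rw [show ((-1 : k) ^ glPar m i' * c ^ r * ((-1) ^ glPar m i * c ^ s) -
      (-1) ^ glPar m i' * c ^ s * ((-1) ^ glPar m i * c ^ r)) = 0 by ring]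
    simp

lemma siteL_mul_siteL (he : IsSiteRep (k := k) m e) {a b : ℕ} (hab : a ≠ b) (c c' : k)
    (i j i' j' : Fin N) (r s : ℕ) :
    coeff r (siteL m e c a i j) * coeff s (siteL m e c' b i' j') =
      swapSign (glPar m) i j i' j' •
        (coeff s (siteL m e c' b i' j') * coeff r (siteL m e c a i j)) := by
  cases r with
  | zero =>
    rw [coeff_zero_siteL]
    split_ifs with h
    · subst h; rw [swapSign_self_left]; simp
    · simp
  | succ r =>
  cases s with
  | zero =>
    rw [coeff_zero_siteL]
    split_ifs with h
    · subst h; rw [swapSign_self_right]; simp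
    · simp
  | succ s =>
    have h := he (i, j, a) (i', j', b)
    simp only [hab, hab.symm, and_false, if_false, smul_zero, sub_zero] at h
    rw [swapSign_smul (k := k) _ _ _ _ a b]
    simp only [coeff_succ_siteL, Polynomial.monomial_mul_monomial]
    rw [Polynomial.smul_monomial, add_comm s r]
    congr 1
    simp only [smul_mul_assoc, mul_smul_comm, sub_eq_zero.1 h]
    module

/-- The product of the matrices attached to the sites `0, …, l - 1`. -/
noncomputable def transfer (m : ℕ) (e : Fin N × Fin N × ℕ → E) (c : ℕ → k) :
    ℕ → Fin N → Fin N → PowerSeries (Polynomial E)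
  | 0 => fun i j => if i = j then 1 else 0
  | l + 1 => fun i j => ∑ q, transfer m e c l i q * siteL m e (c l) l q j

lemma siteL_mul_transfer (he : IsSiteRep (k := k) m e) (c : ℕ → k) {l a : ℕ} (hl : l ≤ a) (c' : k)
    (i j i' j' : Fin N) (r s : ℕ) :
    coeff r (siteL m e c' a i j) * coeff s (transfer m e c l i' j') =
      swapSign (glPar m) i j i' j' •
        (coeff s (transfer m e c l i' j') * coeff r (siteL m e c' a i j)) := by
  induction l generalizing i' j' s with
  | zero =>
    simp only [transfer]
    split_ifs with h
    · subst h; rw [swapSign_self_right, coeff_one]; split_ifs <;> simp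
    · simp
  | succ l ih =>
    simp only [transfer, map_sum, coeff_mul, Finset.mul_sum, Finset.sum_mul, Finset.smul_sum]
    refine Finset.sum_congr rfl fun q _ => Finset.sum_congr rfl fun x _ => ?_
    rw [← mul_assoc, ih (by omega), smul_mul_assoc, mul_assoc, siteL_mul_siteL he (by omega),
      mul_smul_comm, smul_smul, swapSign_mul_right, mul_assoc]

lemma isRTT_transfer (he : IsSiteRep (k := k) m e) (c : ℕ → k) (l : ℕ) :
    IsRTT (glPar m) (transfer m e c l) := by
  induction l with
  | zero =>
    intro i j i' j'
    have h : ∀ i j : Fin N, transfer m e c 0 i j = if i = j then 1 else 0 := fun _ _ => rfl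
    have hC : ∀ p : Prop, ∀ [Decidable p], (C (if p then 1 else 0 : PowerSeries (Polynomial E)) :
        PowerSeries (PowerSeries (Polynomial E))) = if p then 1 else 0 := by
      intro p _; split_ifs <;> simp
    have hm : ∀ p : Prop, ∀ [Decidable p], map C (if p then 1 else 0 : PowerSeries (Polynomial E)) =
        if p then 1 else 0 := by
      intro p _; split_ifs <;> simp
    simp only [h, hC, hm, sub_self, smul_zero]
    split_ifs with h₁ h₂ h₂
    · subst h₁; rw [swapSign_self_left]; simp
    all_goals simp
  | succ l ih => exact ih.mul (isRTT_siteL he (c l) l) fun i j i' j' r s =>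
      siteL_mul_transfer he c le_rfl _ _ _ _ _ _ _

lemma coeff_zero_transfer (c : ℕ → k) (l : ℕ) (i j : Fin N) :
    coeff 0 (transfer m e c l i j) = if i = j then 1 else 0 := by
  induction l generalizing i j with
  | zero => simp only [transfer]; split_ifs <;> simp
  | succ l ih =>
    simp only [transfer, map_sum, coeff_mul, Finset.Nat.antidiagonal_zero, Finset.sum_singleton, ih,
      coeff_zero_siteL]
    simp

lemma natDegree_transfer (c : ℕ → k) (l : ℕ) (i j : Fin N) (r : ℕ) :
    (coeff (r + 1) (transfer m e c l i j)).natDegree ≤ r ∧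
      (coeff (r + 1) (transfer m e c l i j)).coeff r =
        (-1 : k) ^ glPar m i • ∑ a ∈ Finset.range l, c a ^ r • e (i, j, a) := by
  induction l generalizing i j r with
  | zero =>
    simp only [transfer]
    split_ifs <;> simp [coeff_one]
  | succ l ih =>
    obtain ⟨y, hT, hy, hy'⟩ : ∃ y : Polynomial E, coeff (r + 1) (transfer m e c (l + 1) i j) =
        coeff (r + 1) (siteL m e (c l) l i j) + coeff (r + 1) (transfer m e c l i j) + y ∧
        y.natDegree ≤ r ∧ y.coeff r = 0 := by
      simp only [transfer, map_sum, coeff_mul]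
      cases r with
      | zero =>
        refine ⟨0, ?_, by simp, by simp⟩
        simp only [Finset.Nat.sum_antidiagonal_succ, Finset.Nat.antidiagonal_zero,
          Finset.sum_singleton, coeff_zero_transfer, coeff_zero_siteL, Finset.sum_add_distrib]
        simp
      | succ r =>
        have hdeg : (∑ q, ∑ x ∈ Finset.HasAntidiagonal.antidiagonal r,
            coeff (x.1 + 1) (transfer m e c l i q) *
              coeff (x.2 + 1) (siteL m e (c l) l q j)).natDegree ≤ r := by
          refine Polynomial.natDegree_sum_le_of_forall_le _ _ fun q _ =>
            Polynomial.natDegree_sum_le_of_forall_le _ _ fun x hx => ?_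
          rw [← Finset.HasAntidiagonal.mem_antidiagonal.1 hx, coeff_succ_siteL]
          exact Polynomial.natDegree_mul_le.trans (add_le_add (ih i q x.1).1
            (Polynomial.natDegree_monomial_le _))
        refine ⟨_, ?_, hdeg.trans (Nat.le_succ r),
          Polynomial.coeff_eq_zero_of_natDegree_lt (Nat.lt_succ_of_le hdeg)⟩
        simp only [Finset.Nat.sum_antidiagonal_succ, Finset.Nat.sum_antidiagonal_succ' (n := r),
          coeff_zero_transfer, coeff_zero_siteL, Finset.sum_add_distrib]
        simp [add_assoc]
    rw [hT]
    refine ⟨Polynomial.natDegree_add_le_of_degree_le (Polynomial.natDegree_add_le_of_degree_le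
      ?_ (ih i j r).1) hy, ?_⟩
    · rw [coeff_succ_siteL]
      exact Polynomial.natDegree_monomial_le _
    · rw [Polynomial.coeff_add, Polynomial.coeff_add, hy', (ih i j r).2, add_zero,
        coeff_succ_siteL, Polynomial.coeff_monomial, if_pos rfl, Finset.sum_range_succ, smul_add,
        add_comm, smul_smul]

end Transfer

section YangianRep

variable {k : Type*} [Field k] {m n : ℕ} {E : Type*} [Ring E] [Algebra k E]
  {e : Fin (m + n) × Fin (m + n) × ℕ → E}

lemma lift_tFree_transfer (c : ℕ → k) (l : ℕ) (i j : Fin (m + n)) (r : ℕ) :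
    FreeAlgebra.lift k (fun x : Fin (m + n) × Fin (m + n) × ℕ =>
      PowerSeries.coeff (x.2.2 + 1) (transfer m e c l x.1 x.2.1)) (tFree k m n i j r) =
      PowerSeries.coeff r (transfer m e c l i j) := by
  cases r with
  | zero => rw [coeff_zero_transfer, tFree]; split_ifs <;> simp
  | succ r => simp [tFree]

/-- The representation of the super Yangian on the sites `0, …, l - 1`. -/
noncomputable def yangianRep (he : IsSiteRep (k := k) m e) (c : ℕ → k) (l : ℕ) :
    Yangian k m n →ₐ[k] Polynomial E :=
  RingQuot.liftAlgHom k ⟨FreeAlgebra.lift k (fun x =>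
      PowerSeries.coeff (x.2.2 + 1) (transfer m e c l x.1 x.2.1)), by
    rintro _ _ ⟨i, j, i', j', r, s⟩
    simp only [map_sub, map_mul, map_zsmul, map_sum, lift_tFree_transfer]
    have h := (isRTT_transfer he c l).bracket_eq_sum (coeff_zero_transfer c l) i j i' j'
      (r + 1) (s + 1)
    rw [show r + 1 + (s + 1) - 1 = r + s + 1 by omega] at h
    exact h⟩

lemma yangianRep_tY (he : IsSiteRep (k := k) m e) (c : ℕ → k) (l : ℕ) (i j : Fin (m + n)) (r : ℕ) :
    yangianRep he c l (tY k m n i j r) = PowerSeries.coeff r (transfer m e c l i j) := by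
  rw [yangianRep, tY, RingQuot.liftAlgHom_mkAlgHom_apply, lift_tFree_transfer]

/-- The map from the free algebra to the super Yangian sending the letter `(i, j, r)` to
`(-1)^{|i|} t_{i,j}^{(r+1)}`. -/
noncomputable def yMap (k : Type*) [Field k] (m n : ℕ) :
    FreeAlgebra k (Fin (m + n) × Fin (m + n) × ℕ) →ₐ[k] Yangian k m n :=
  FreeAlgebra.lift k fun x => (-1 : k) ^ glPar m x.1 • tY k m n x.1 x.2.1 (x.2.2 + 1)

/-- The weight of the letter `(i, j, r)` for the loop filtration. -/
def loopWeight {N : ℕ} (x : Fin N × Fin N × ℕ) : ℕ := x.2.2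

/-- The operator by which `e_{i,j} x^r` acts on the sites `0, …, l - 1` placed at the points `c`. -/
noncomputable def evalRep (c : ℕ → k) (e : Fin (m + n) × Fin (m + n) × ℕ → E) (l : ℕ) :
    FreeAlgebra k (Fin (m + n) × Fin (m + n) × ℕ) →ₐ[k] E :=
  FreeAlgebra.lift k fun x => ∑ a ∈ Finset.range l, c a ^ x.2.2 • e (x.1, x.2.1, a)

lemma evalRep_proj_eq_zero (he : IsSiteRep (k := k) m e) (c : ℕ → k) (l : ℕ) {r : ℕ}
    {f : FreeAlgebra k (Fin (m + n) × Fin (m + n) × ℕ)}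
    (hf : f ∈ FreeAlgebra.wordsLT k loopWeight (r + 1)) (h : yMap k m n f = 0) :
    evalRep c e l (FreeAlgebra.proj k loopWeight r f) = 0 := by
  have hx : ∀ x : Fin (m + n) × Fin (m + n) × ℕ,
      ((yangianRep he c l).comp (yMap k m n)) (FreeAlgebra.ι k x) = (-1 : k) ^ glPar m x.1 •
        PowerSeries.coeff (x.2.2 + 1) (transfer m e c l x.1 x.2.1) := by
    intro x
    simp [yMap, yangianRep_tY]
  rw [← FreeAlgebra.coeff_eq_of_leading ((yangianRep he c l).comp (yMap k m n)) (evalRep c e l)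
    ?_ ?_ hf]
  · simp [h]
  · intro x
    rw [hx]
    exact (Polynomial.natDegree_smul_le _ _).trans (natDegree_transfer _ _ _ _ _).1
  · intro x
    rw [hx, Polynomial.coeff_smul, loopWeight, (natDegree_transfer _ _ _ _ _).2, smul_smul,
      ← mul_pow]
    simp [evalRep]

end YangianRep

namespace FreeAlgebra

variable {k : Type*} [Field k] {X : Type*}

lemma ι_mem_wordsLT {ω : X → ℕ} {r : ℕ} {x : X} (h : ω x < r) : ι k x ∈ wordsLT k ω r :=
  Submodule.subset_span ⟨[x], by simpa using h, by simp⟩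

lemma ι_mem_wordsEQ (ω : X → ℕ) (x : X) : ι k x ∈ wordsEQ k ω (ω x) :=
  Submodule.subset_span ⟨[x], by simp, by simp⟩

lemma ι_mul_ι_mem_wordsEQ (ω : X → ℕ) (x y : X) :
    ι k x * ι k y ∈ wordsEQ k ω (ω x + ω y) :=
  Submodule.subset_span ⟨[x, y], by simp, by simp⟩

lemma wordsLT_mono (ω : X → ℕ) {r s : ℕ} (h : r ≤ s) : wordsLT k ω r ≤ wordsLT k ω s :=
  Submodule.span_mono fun _ ⟨l, hl, hf⟩ => ⟨l, hl.trans_le h, hf⟩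

lemma exists_mem_wordsLT (ω : X → ℕ) (f : FreeAlgebra k X) : ∃ r, f ∈ wordsLT k ω r := by
  have hf : f ∈ Submodule.span k (Set.range (word k (X := X))) := by
    rw [span_range_word]; trivial
  induction hf using Submodule.span_induction with
  | mem x hx =>
    obtain ⟨w, rfl⟩ := hx
    exact ⟨_, word_mem_wordsLT (Nat.lt_succ_self _)⟩
  | zero => exact ⟨0, zero_mem _⟩
  | add x y _ _ hx hy =>
    obtain ⟨r, hr⟩ := hx
    obtain ⟨s, hs⟩ := hy
    exact ⟨max r s, add_mem (wordsLT_mono ω (le_max_left r s) hr)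
      (wordsLT_mono ω (le_max_right r s) hs)⟩
  | smul a x _ hx =>
    obtain ⟨r, hr⟩ := hx
    exact ⟨r, Submodule.smul_mem _ _ hr⟩

end FreeAlgebra

section EvalRep

variable {k : Type*} [Field k] {m n : ℕ} {E : Type*} [Ring E] [Algebra k E]
  {e : Fin (m + n) × Fin (m + n) × ℕ → E}

lemma neg_one_pow_smul_eq_superSign {V : Type*} [AddCommGroup V] [Module k V] {N : ℕ}
    (a b : Fin N × Fin N × ℕ) (v : V) :
    ((-1 : ℤ) ^ ((glPar m a.1 + glPar m a.2.1) * (glPar m b.1 + glPar m b.2.1))) • v =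
      superSign k m a b • v := by
  rw [← Int.cast_smul_eq_zsmul k, superSign]; simp

lemma evalRep_eq_of_uRel (he : IsSiteRep (k := k) m e) (c : ℕ → k) (l : ℕ)
    {x y : FreeAlgebra k (Fin (m + n) × Fin (m + n) × ℕ)} (h : URel k m n x y) :
    evalRep c e l x = evalRep c e l y := by
  obtain ⟨a, b⟩ := h
  obtain ⟨i, j, r⟩ := a
  obtain ⟨i', j', s⟩ := b
  simp only [neg_one_pow_smul_eq_superSign (k := k) (m := m) (i, j, r) (i', j', s),
    map_sub, map_mul, map_smul, apply_ite (evalRep c e l), map_zero]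
  simp only [evalRep, FreeAlgebra.lift_ι_apply, Finset.sum_mul_sum]
  rw [Finset.sum_comm (s := Finset.range l) (t := Finset.range l)
    (f := fun a b => c a ^ s • e (i', j', a) * c b ^ r • e (i, j, b)), Finset.smul_sum,
    ← Finset.sum_sub_distrib]
  simp only [Finset.smul_sum, ← Finset.sum_sub_distrib]
  have hab : ∀ a b, c a ^ r • e (i, j, a) * c b ^ s • e (i', j', b) -
      superSign k m (i, j, r) (i', j', s) • (c b ^ s • e (i', j', b) * c a ^ r • e (i, j, a)) =
      if a = b then c a ^ (r + s) • ((if i' = j then e (i, j', a) else 0) -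
        superSign k m (i, j, r) (i', j', s) • if j' = i then e (i', j, a) else 0) else 0 := by
    intro a b
    have h := he (i, j, a) (i', j', b)
    rw [show superSign k m (i, j, a) (i', j', b) = superSign k m (i, j, r) (i', j', s) from rfl]
      at h
    have h' : c a ^ r • e (i, j, a) * c b ^ s • e (i', j', b) -
      superSign k m (i, j, r) (i', j', s) • (c b ^ s • e (i', j', b) * c a ^ r • e (i, j, a)) =
      (c a ^ r * c b ^ s) • (e (i, j, a) * e (i', j', b) -
        superSign k m (i, j, r) (i', j', s) • (e (i', j', b) * e (i, j, a))) := by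
      simp only [smul_mul_assoc, mul_smul_comm]
      module
    rw [h', h]
    by_cases hab : a = b
    · subst hab
      simp only [and_true, if_true, pow_add, eq_comm (a := i)]
    · simp [hab, Ne.symm hab]
  simp only [hab]
  simp only [Finset.sum_ite_eq, Finset.mem_range]
  rw [Finset.sum_congr rfl (fun a ha => if_pos (Finset.mem_range.1 ha))]
  simp only [smul_sub, Finset.sum_sub_distrib]
  congr 1
  · split_ifs <;> simp
  · split_ifs
    · rw [Finset.smul_sum]
      exact Finset.sum_congr rfl fun a _ => smul_comm _ _ _
    · simp

lemma evalRep_eq_of_mk_eq (he : IsSiteRep (k := k) m e) (c : ℕ → k) (l : ℕ)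
    {x y : FreeAlgebra k (Fin (m + n) × Fin (m + n) × ℕ)}
    (h : RingQuot.mkAlgHom k (URel k m n) x = RingQuot.mkAlgHom k (URel k m n) y) :
    evalRep c e l x = evalRep c e l y := by
  have h' := congrArg (RingQuot.liftAlgHom k
    ⟨evalRep c e l, fun _ _ hxy => evalRep_eq_of_uRel he c l hxy⟩) h
  simpa only [RingQuot.liftAlgHom_mkAlgHom_apply] using h'

end EvalRep

lemma exists_dual_vandermonde {k : Type*} [Field k] {c : ℕ → k} (hc : Function.Injective c)
    (l : ℕ) : ∃ μ : ℕ → ℕ → k, ∀ r < l, ∀ s < l,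
      ∑ a ∈ Finset.range l, c a ^ r * μ a s = if r = s then 1 else 0 := by
  have hdet : IsUnit (Matrix.vandermonde fun a : Fin l => c a).transpose.det := by
    rw [Matrix.det_transpose, isUnit_iff_ne_zero, Matrix.det_vandermonde_ne_zero_iff]
    exact hc.comp Fin.val_injective
  refine ⟨fun a s => if h : a < l ∧ s < l then
    (Matrix.vandermonde fun a : Fin l => c a).transpose⁻¹ ⟨a, h.1⟩ ⟨s, h.2⟩ else 0, ?_⟩
  intro r hr s hs
  have h := congrFun (congrFun (Matrix.mul_nonsing_inv _ hdet) ⟨r, hr⟩) ⟨s, hs⟩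
  rw [Matrix.mul_apply, Matrix.one_apply] at h
  rw [Finset.sum_range]
  simpa [hs] using h

namespace SuperSym

variable {k : Type*} [Field k] {m n : ℕ}

lemma isSiteRep_act : IsSiteRep (k := k) m (act k (m := m) (n := n)) := act_mul_act

lemma mk_word (w : List (Fin (m + n) × Fin (m + n) × ℕ)) :
    RingQuot.mkAlgHom k (SymRel k m n) (FreeAlgebra.word k w) = (w.map (gen k)).prod := by
  rw [FreeAlgebra.word, map_list_prod, List.map_map]
  rfl

/-- The elements of degree at most `d` of the supersymmetric algebra. -/
noncomputable def degLE (k : Type*) [Field k] (m n d : ℕ) : Submodule k (SuperSym k m n) :=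
  (FreeAlgebra.wordsLT k (fun _ => 1) (d + 1)).map
    (RingQuot.mkAlgHom k (SymRel k m n)).toLinearMap

lemma degLE_induction {d : ℕ} (M : Submodule k (SuperSym k m n))
    (h : ∀ w : List (Fin (m + n) × Fin (m + n) × ℕ), w.length ≤ d → (w.map (gen k)).prod ∈ M) :
    degLE k m n d ≤ M := by
  rw [degLE, Submodule.map_le_iff_le_comap, FreeAlgebra.wordsLT, Submodule.span_le]
  rintro _ ⟨w, hw, rfl⟩
  have := h w (by simpa [FreeAlgebra.weight, Nat.lt_succ_iff] using hw)
  rwa [← mk_word] at this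

lemma prod_gen_mem_degLE {d : ℕ} {w : List (Fin (m + n) × Fin (m + n) × ℕ)} (hw : w.length ≤ d) :
    (w.map (gen k)).prod ∈ degLE k m n d := by
  refine ⟨FreeAlgebra.word k w, FreeAlgebra.word_mem_wordsLT
    (by simpa [FreeAlgebra.weight, Nat.lt_succ_iff] using hw), mk_word w⟩

lemma degLE_mono {d d' : ℕ} (h : d ≤ d') : degLE k m n d ≤ degLE k m n d' :=
  degLE_induction _ fun _ hw => prod_gen_mem_degLE (hw.trans h)

lemma gen_mul_mem_degLE (a : Fin (m + n) × Fin (m + n) × ℕ) {d : ℕ} {s : SuperSym k m n}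
    (hs : s ∈ degLE k m n d) : gen k a * s ∈ degLE k m n (d + 1) := by
  refine degLE_induction ((degLE k m n (d + 1)).comap (LinearMap.mulLeft k (gen k a)))
    (fun w hw => ?_) hs
  exact prod_gen_mem_degLE (w := a :: w) (by simpa using hw)

lemma der_mem_degLE (a : Fin (m + n) × Fin (m + n) × ℕ) {d : ℕ} {s : SuperSym k m n}
    (hs : s ∈ degLE k m n d) : der k a s ∈ degLE k m n d := by
  refine degLE_induction ((degLE k m n d).comap (der k a)) (fun w hw => ?_) hs
  refine degLE_mono hw ?_
  clear hs hw
  induction w with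
  | nil => simp
  | cons b w ih =>
    rw [List.map_cons, List.prod_cons, der_gen_mul]
    refine Submodule.add_mem _ (Submodule.smul_mem _ _ (gen_mul_mem_degLE b ih)) ?_
    rw [siteMul]
    split_ifs
    · exact gen_mul_mem_degLE _ (prod_gen_mem_degLE le_rfl)
    · simp

/-- The algebra map multiplying the variable at the site `a` by the formal variable and expanding
it as `∑ r < l, μ a r • gen (i, j, r)`. -/
noncomputable def interp (μ : ℕ → ℕ → k) (l : ℕ) :
    SuperSym k m n →ₐ[k] Polynomial (SuperSym k m n) :=
  lift (fun x => Polynomial.monomial 1 (∑ r ∈ Finset.range l, μ x.2.2 r • gen k (x.1, x.2.1, r)))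
    (by
      intro a b
      rw [Polynomial.monomial_mul_monomial, Polynomial.monomial_mul_monomial,
        Polynomial.smul_monomial, Finset.sum_mul_sum, Finset.sum_mul_sum, Finset.sum_comm]
      congr 1
      simp only [Finset.smul_sum]
      refine Finset.sum_congr rfl fun r _ => Finset.sum_congr rfl fun s _ => ?_
      rw [smul_mul_smul_comm, smul_mul_smul_comm, gen_mul_gen, smul_comm, mul_comm]
      rfl)

lemma interp_gen (μ : ℕ → ℕ → k) (l : ℕ) (x : Fin (m + n) × Fin (m + n) × ℕ) :
    interp μ l (gen k x) =
      Polynomial.monomial 1 (∑ r ∈ Finset.range l, μ x.2.2 r • gen k (x.1, x.2.1, r)) :=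
  lift_gen _ _ x

lemma natDegree_interp (μ : ℕ → ℕ → k) (l : ℕ) {d : ℕ} {s : SuperSym k m n}
    (hs : s ∈ degLE k m n d) {d' : ℕ} (hd : d < d') : (interp μ l s).coeff d' = 0 := by
  refine degLE_induction (LinearMap.ker
    ((Polynomial.lcoeff (SuperSym k m n) d').restrictScalars k ∘ₗ (interp μ l).toLinearMap))
    (fun w hw => ?_) hs
  change (interp μ l (w.map (gen k)).prod).coeff d' = 0
  refine Polynomial.coeff_eq_zero_of_natDegree_lt (lt_of_le_of_lt (hw.trans' ?_) hd)
  clear hw hs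
  induction w with
  | nil => simp
  | cons b w ih =>
    rw [List.map_cons, List.prod_cons, map_mul, interp_gen, List.length_cons, add_comm w.length]
    exact Polynomial.natDegree_mul_le.trans (add_le_add (Polynomial.natDegree_monomial_le _) ih)

lemma evalRep_act_word {c : ℕ → k} {μ : ℕ → ℕ → k} {l : ℕ}
    (hμ : ∀ r < l, ∀ s < l, ∑ a ∈ Finset.range l, c a ^ r * μ a s = if r = s then 1 else 0)
    (w : List (Fin (m + n) × Fin (m + n) × ℕ)) (hw : ∀ x ∈ w, x.2.2 < l) :
    evalRep c (act k) l (FreeAlgebra.word k w) (1 : SuperSym k m n) ∈ degLE k m n w.length ∧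
    (interp μ l (evalRep c (act k) l (FreeAlgebra.word k w) (1 : SuperSym k m n))).coeff
      w.length = (w.map (gen k)).prod := by
  induction w with
  | nil => exact ⟨by simpa using prod_gen_mem_degLE (k := k) (m := m) (n := n) (w := []) le_rfl,
      by simp⟩
  | cons x w ih =>
    obtain ⟨i, j, r⟩ := x
    obtain ⟨h₁, h₂⟩ := ih fun x hx => hw x (List.mem_cons_of_mem _ hx)
    have hr : r < l := hw _ List.mem_cons_self
    have heq : evalRep c (act k) l (FreeAlgebra.word k ((i, j, r) :: w)) (1 : SuperSym k m n) =
        ∑ a ∈ Finset.range l, c a ^ r •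
          (gen k (i, j, a) * evalRep c (act k) l (FreeAlgebra.word k w) (1 : SuperSym k m n) +
            der k (i, j, a)
              (evalRep c (act k) l (FreeAlgebra.word k w) (1 : SuperSym k m n))) := by
      rw [FreeAlgebra.word_cons, map_mul, Module.End.mul_apply, evalRep,
        FreeAlgebra.lift_ι_apply, LinearMap.sum_apply]
      rfl
    rw [heq]
    set s := evalRep c (act k) l (FreeAlgebra.word k w) (1 : SuperSym k m n)
    refine ⟨Submodule.sum_mem _ fun a _ => Submodule.smul_mem _ _ (Submodule.add_mem _
      (gen_mul_mem_degLE _ h₁) (degLE_mono (Nat.le_succ _) (der_mem_degLE _ h₁))), ?_⟩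
    rw [map_sum, Polynomial.finsetSum_coeff, List.length_cons, List.map_cons, List.prod_cons]
    have hterm : ∀ a ∈ Finset.range l,
        (interp μ l (c a ^ r • (gen k (i, j, a) * s + der k (i, j, a) s))).coeff (w.length + 1) =
          ∑ t ∈ Finset.range l, (c a ^ r * μ a t) • (gen k (i, j, t) * (w.map (gen k)).prod) := by
      intro a _
      rw [map_smul, Polynomial.coeff_smul, map_add, Polynomial.coeff_add,
        natDegree_interp μ l (der_mem_degLE _ h₁) (Nat.lt_succ_self _), add_zero, map_mul,
        interp_gen, Polynomial.coeff_monomial_mul, h₂, Finset.sum_mul, Finset.smul_sum]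
      simp only [smul_mul_assoc, smul_smul]
    rw [Finset.sum_congr rfl hterm, Finset.sum_comm]
    have hsum : ∀ t ∈ Finset.range l, ∑ a ∈ Finset.range l,
        (c a ^ r * μ a t) • (gen k (i, j, t) * (w.map (gen k)).prod) =
          if r = t then gen k (i, j, t) * (w.map (gen k)).prod else 0 := by
      intro t ht
      rw [← Finset.sum_smul, hμ r hr t (Finset.mem_range.1 ht)]
      split_ifs <;> simp
    rw [Finset.sum_congr rfl hsum, Finset.sum_ite_eq, if_pos (Finset.mem_range.2 hr)]

lemma exists_coeff_evalRep_act {c : ℕ → k} {μ : ℕ → ℕ → ℕ → k}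
    (hμ : ∀ l, ∀ r < l, ∀ s < l,
      ∑ a ∈ Finset.range l, c a ^ r * μ l a s = if r = s then 1 else 0) {d : ℕ}
    {f : FreeAlgebra k (Fin (m + n) × Fin (m + n) × ℕ)}
    (hf : f ∈ FreeAlgebra.wordsLT k (fun _ => 1) (d + 1)) :
    ∃ l₀, ∀ l ≥ l₀, (interp (μ l) l (evalRep c (act k) l f (1 : SuperSym k m n))).coeff d =
      RingQuot.mkAlgHom k (SymRel k m n) (FreeAlgebra.proj k (fun _ => 1) d f) := by
  rw [FreeAlgebra.wordsLT] at hf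
  induction hf using Submodule.span_induction with
  | mem x hx =>
    obtain ⟨w, hw, rfl⟩ := hx
    have hlen : FreeAlgebra.weight (fun _ => 1) w = w.length := by simp [FreeAlgebra.weight]
    replace hw : w.length ≤ d := by
      have : FreeAlgebra.weight (fun _ => 1) w < d + 1 := hw
      lia
    refine ⟨(w.map fun x => x.2.2).sum + 1, fun l hl => ?_⟩
    have hwl : ∀ x ∈ w, x.2.2 < l := fun x hx => by
      have := List.single_le_sum (l := w.map fun x => x.2.2) (by simp) _
        (List.mem_map_of_mem hx)
      lia
    obtain ⟨h₁, h₂⟩ := evalRep_act_word (hμ l) w hwl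
    rw [FreeAlgebra.proj_word, hlen]
    split_ifs with h
    · rw [← h, h₂, mk_word]
    · rw [map_zero, natDegree_interp _ _ h₁ (lt_of_le_of_ne hw h)]
  | zero => exact ⟨0, fun l _ => by simp⟩
  | add x y _ _ hx hy =>
    obtain ⟨l₁, h₁⟩ := hx
    obtain ⟨l₂, h₂⟩ := hy
    refine ⟨max l₁ l₂, fun l hl => ?_⟩
    rw [map_add, map_add, map_add, LinearMap.add_apply, map_add, Polynomial.coeff_add,
      h₁ l (le_of_max_le_left hl), h₂ l (le_of_max_le_right hl)]
  | smul a x _ hx =>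
    obtain ⟨l₁, h₁⟩ := hx
    refine ⟨l₁, fun l hl => ?_⟩
    rw [map_smul, map_smul, map_smul, LinearMap.smul_apply, map_smul, Polynomial.coeff_smul,
      h₁ l hl]

end SuperSym

section PBW

variable {k : Type*} [Field k] {m n : ℕ}

lemma symRel_leading {x y : FreeAlgebra k (Fin (m + n) × Fin (m + n) × ℕ)}
    (h : SymRel k m n x y) : ∃ e, x - y ∈ FreeAlgebra.wordsEQ k (fun _ => 1) e ∧
      RingQuot.mkAlgHom k (URel k m n) (x - y) ∈ (FreeAlgebra.wordsLT k (fun _ => 1) e).map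
        (RingQuot.mkAlgHom k (URel k m n)).toLinearMap := by
  obtain ⟨a, b⟩ := h
  have hs : ∀ a : Fin (m + n) × Fin (m + n) × ℕ,
      FreeAlgebra.ι k a ∈ FreeAlgebra.wordsLT k (fun _ => 1) 2 := fun a =>
    FreeAlgebra.ι_mem_wordsLT (Nat.lt_succ_self _)
  refine ⟨2, Submodule.sub_mem _ (FreeAlgebra.ι_mul_ι_mem_wordsEQ (fun _ => 1) a b)
    (Submodule.smul_mem _ _ (FreeAlgebra.ι_mul_ι_mem_wordsEQ (fun _ => 1) b a)), ?_⟩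
  have h := RingQuot.mkAlgHom_rel k (URel.rel (k := k) (m := m) (n := n) a b)
  simp only [neg_one_pow_smul_eq_superSign (k := k)] at h
  refine ⟨_, Submodule.sub_mem _ (?_ : _ ∈ FreeAlgebra.wordsLT k (fun _ => 1) 2)
    (Submodule.smul_mem _ (superSign k m a b) ?_), h.symm⟩
  · split_ifs
    exacts [hs _, zero_mem _]
  · split_ifs
    exacts [hs _, zero_mem _]

/-- The evaluation modules on the supersymmetric algebra jointly detect the enveloping algebra. -/
theorem mkAlgHom_uRel_eq_zero {c : ℕ → k} (hc : Function.Injective c)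
    {f : FreeAlgebra k (Fin (m + n) × Fin (m + n) × ℕ)}
    (hf : ∀ l, evalRep c (SuperSym.act k (m := m) (n := n)) l f = 0) :
    RingQuot.mkAlgHom k (URel k m n) f = 0 := by
  choose μ hμ using fun l => exists_dual_vandermonde hc l
  have key : ∀ d (f : FreeAlgebra k (Fin (m + n) × Fin (m + n) × ℕ)),
      f ∈ FreeAlgebra.wordsLT k (fun _ => 1) d →
      (∀ l, evalRep c (SuperSym.act k (m := m) (n := n)) l f = 0) →
      RingQuot.mkAlgHom k (URel k m n) f = 0 := by
    intro d
    induction d with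
    | zero =>
      intro f hf _
      rw [FreeAlgebra.wordsLT_zero, Submodule.mem_bot] at hf
      rw [hf, map_zero]
    | succ d ih =>
      intro f hfd hf
      obtain ⟨l₀, h₀⟩ := SuperSym.exists_coeff_evalRep_act hμ hfd
      have hsym := (h₀ l₀ le_rfl).symm
      rw [hf, LinearMap.zero_apply, map_zero, Polynomial.coeff_zero] at hsym
      have hmem := FreeAlgebra.proj_mem_of_mkAlgHom_eq_zero (fun _ => 1)
        (RingQuot.mkAlgHom k (URel k m n)) (fun _ _ => symRel_leading) hsym d
      rw [FreeAlgebra.proj_proj] at hmem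
      obtain ⟨g, hg, hgf⟩ := hmem
      replace hgf : RingQuot.mkAlgHom k (URel k m n) g =
        RingQuot.mkAlgHom k (URel k m n) (FreeAlgebra.proj k (fun _ => 1) d f) := hgf
      have heq : RingQuot.mkAlgHom k (URel k m n) f = RingQuot.mkAlgHom k (URel k m n)
          (g + (f - FreeAlgebra.proj k (fun _ => 1) d f)) := by
        rw [map_add, hgf, ← map_add, add_sub_cancel]
      rw [heq]
      refine ih _ (Submodule.add_mem _ hg (FreeAlgebra.sub_proj_mem_wordsLT hfd)) fun l => ?_
      rw [← evalRep_eq_of_mk_eq SuperSym.isSiteRep_act c l heq, hf l]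
  obtain ⟨d, hd⟩ := FreeAlgebra.exists_mem_wordsLT (fun _ => 1) f
  exact key d f hd hf

end PBW

section Symbol

variable {k : Type*} [Field k] {m n : ℕ}

lemma neg_one_pow_zsmul {V : Type*} [AddCommGroup V] [Module k V] (e : ℕ) (v : V) :
    ((-1 : ℤ) ^ e) • v = (-1 : k) ^ e • v := by
  rw [← Int.cast_smul_eq_zsmul k]; simp

lemma tY_zero (i j : Fin (m + n)) : tY k m n i j 0 = if i = j then 1 else 0 := by
  rw [tY, tFree]; split_ifs <;> simp

lemma yMap_ι (x : Fin (m + n) × Fin (m + n) × ℕ) :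
    yMap k m n (FreeAlgebra.ι k x) = (-1 : k) ^ glPar m x.1 • tY k m n x.1 x.2.1 (x.2.2 + 1) :=
  FreeAlgebra.lift_ι_apply _ _

lemma tY_succ_eq (i j : Fin (m + n)) (r : ℕ) :
    tY k m n i j (r + 1) = yMap k m n ((-1 : k) ^ glPar m i • FreeAlgebra.ι k (i, j, r)) := by
  rw [map_smul, yMap_ι, smul_smul, ← mul_pow]; simp

lemma tY_comm (i j i' j' : Fin (m + n)) (r s : ℕ) :
    tY k m n i j (r + 1) * tY k m n i' j' (s + 1) -
        superSign k m (i, j, r) (i', j', s) •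
          (tY k m n i' j' (s + 1) * tY k m n i j (r + 1)) =
      (-1 : k) ^ (glPar m i * glPar m j + glPar m i * glPar m i' + glPar m j * glPar m i') •
        ∑ t ∈ Finset.range (min (r + 1) (s + 1)),
          (tY k m n i' j t * tY k m n i j' (r + s + 1 - t) -
            tY k m n i' j (r + s + 1 - t) * tY k m n i j' t) := by
  have h := RingQuot.mkAlgHom_rel k (YRel.rel (k := k) (m := m) (n := n) i j i' j' r s)
  simp only [neg_one_pow_zsmul (k := k), map_sub, map_mul, map_smul, map_sum] at h
  exact h

lemma tY_mul_tY_mem (i j i' j' : Fin (m + n)) {r s d : ℕ} (h : r + s < d) :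
    tY k m n i j (r + 1) * tY k m n i' j' (s + 1) ∈
      (FreeAlgebra.wordsLT k loopWeight d).map (yMap k m n).toLinearMap := by
  rw [tY_succ_eq, tY_succ_eq, ← map_mul]
  refine ⟨_, ?_, rfl⟩
  rw [smul_mul_smul_comm]
  refine Submodule.smul_mem _ _ (FreeAlgebra.wordsLT_mono loopWeight h
    (FreeAlgebra.wordsEQ_le_wordsLT _ _ ?_))
  exact FreeAlgebra.ι_mul_ι_mem_wordsEQ loopWeight (i, j, r) (i', j', s)

lemma uRel_leading {x y : FreeAlgebra k (Fin (m + n) × Fin (m + n) × ℕ)}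
    (h : URel k m n x y) : ∃ e, x - y ∈ FreeAlgebra.wordsEQ k loopWeight e ∧
      yMap k m n (x - y) ∈
        (FreeAlgebra.wordsLT k loopWeight e).map (yMap k m n).toLinearMap := by
  obtain ⟨⟨i, j, r⟩, ⟨i', j', s⟩⟩ := h
  simp only [neg_one_pow_smul_eq_superSign (k := k) (m := m) (i, j, r) (i', j', s)]
  refine ⟨r + s, ?_, ?_⟩
  · refine Submodule.sub_mem _ (Submodule.sub_mem _ ?_ (Submodule.smul_mem _ _ ?_))
      (Submodule.sub_mem _ ?_ (Submodule.smul_mem _ _ ?_))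
    · exact FreeAlgebra.ι_mul_ι_mem_wordsEQ loopWeight (i, j, r) (i', j', s)
    · rw [add_comm r s]
      exact FreeAlgebra.ι_mul_ι_mem_wordsEQ loopWeight (i', j', s) (i, j, r)
    · split_ifs
      exacts [FreeAlgebra.ι_mem_wordsEQ loopWeight (i, j', r + s), zero_mem _]
    · split_ifs
      exacts [FreeAlgebra.ι_mem_wordsEQ loopWeight (i', j, r + s), zero_mem _]
  · set σ : k := (-1) ^ glPar m i * (-1) ^ glPar m i' *
      (-1) ^ (glPar m i * glPar m j + glPar m i * glPar m i' + glPar m j * glPar m i') with hσ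
    have hlead : σ • (tY k m n i' j 0 * tY k m n i j' (r + s + 1) -
        tY k m n i' j (r + s + 1) * tY k m n i j' 0) =
        yMap k m n ((if i' = j then FreeAlgebra.ι k (i, j', r + s) else 0) -
          superSign k m (i, j, r) (i', j', s) •
            if j' = i then FreeAlgebra.ι k (i', j, r + s) else 0) := by
      have h₁ : i' = j → σ = (-1) ^ glPar m i := by
        rintro rfl
        rcases glPar_eq_zero_or_one m i with h | h <;>
        rcases glPar_eq_zero_or_one m i' with h' | h' <;> norm_num [hσ, h, h']
      have h₂ : j' = i → σ = superSign k m (i, j, r) (i', j', s) * (-1) ^ glPar m i' := by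
        rintro rfl
        rcases glPar_eq_zero_or_one m j' with h | h <;>
        rcases glPar_eq_zero_or_one m i' with h' | h' <;>
        rcases glPar_eq_zero_or_one m j with h'' | h'' <;>
        norm_num [hσ, superSign, h, h', h'']
      rw [map_sub, map_smul, apply_ite (yMap k m n), apply_ite (yMap k m n), map_zero, yMap_ι,
        yMap_ι, tY_zero, tY_zero, smul_sub]
      simp only [eq_comm (a := i)]
      congr 1
      · split_ifs with h
        · rw [h₁ h, one_mul]
        · rw [zero_mul, smul_zero]
      · split_ifs with h
        · rw [h₂ h, mul_one, smul_smul]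
        · rw [mul_zero, smul_zero, smul_zero]
    have hcomm : yMap k m n (FreeAlgebra.ι k (i, j, r) * FreeAlgebra.ι k (i', j', s) -
        superSign k m (i, j, r) (i', j', s) •
          (FreeAlgebra.ι k (i', j', s) * FreeAlgebra.ι k (i, j, r))) =
        ((-1 : k) ^ glPar m i * (-1) ^ glPar m i') •
          (tY k m n i j (r + 1) * tY k m n i' j' (s + 1) -
            superSign k m (i, j, r) (i', j', s) •
              (tY k m n i' j' (s + 1) * tY k m n i j (r + 1))) := by
      rw [map_sub, map_smul, map_mul, map_mul, yMap_ι, yMap_ι, smul_mul_smul_comm,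
        smul_mul_smul_comm, smul_sub, smul_comm (superSign k m (i, j, r) (i', j', s)),
        mul_comm ((-1 : k) ^ glPar m (i', j', s).1)]
    rw [map_sub, hcomm, ← hlead, tY_comm, smul_smul, ← hσ, Nat.add_min_add_right,
      Finset.sum_range_succ', smul_add, Nat.sub_zero, add_sub_cancel_right]
    refine Submodule.smul_mem _ _ (Submodule.sum_mem _ fun t ht => ?_)
    have ht' : t < r ∧ t < s := by simpa using ht
    have he : r + s + 1 - (t + 1) = (r + s - (t + 1)) + 1 := by lia
    rw [he]
    exact Submodule.sub_mem _ (tY_mul_tY_mem _ _ _ _ (by lia)) (tY_mul_tY_mem _ _ _ _ (by lia))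

lemma yMap_mem_of_mk_proj_eq_zero {r : ℕ} {f : FreeAlgebra k (Fin (m + n) × Fin (m + n) × ℕ)}
    (hf : f ∈ FreeAlgebra.wordsLT k loopWeight (r + 1))
    (h : RingQuot.mkAlgHom k (URel k m n) (FreeAlgebra.proj k loopWeight r f) = 0) :
    yMap k m n f ∈ (FreeAlgebra.wordsLT k loopWeight r).map (yMap k m n).toLinearMap := by
  have h' := FreeAlgebra.proj_mem_of_mkAlgHom_eq_zero loopWeight (yMap k m n)
    (fun _ _ => uRel_leading) h r
  rw [FreeAlgebra.proj_proj] at h'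
  have h'' := Submodule.add_mem _ h' (Submodule.mem_map_of_mem (f := (yMap k m n).toLinearMap)
    (FreeAlgebra.sub_proj_mem_wordsLT hf))
  rwa [AlgHom.toLinearMap_apply, ← map_add, add_sub_cancel] at h''

lemma mk_proj_eq_zero_of_yMap_eq_zero [Infinite k] {r : ℕ}
    {f : FreeAlgebra k (Fin (m + n) × Fin (m + n) × ℕ)}
    (hf : f ∈ FreeAlgebra.wordsLT k loopWeight (r + 1)) (h : yMap k m n f = 0) :
    RingQuot.mkAlgHom k (URel k m n) (FreeAlgebra.proj k loopWeight r f) = 0 :=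
  mkAlgHom_uRel_eq_zero (Infinite.natEmbedding k).injective fun l =>
    evalRep_proj_eq_zero SuperSym.isSiteRep_act _ l hf h

lemma yMap_word (w : List (Fin (m + n) × Fin (m + n) × ℕ)) :
    ∃ u : k, u * u = 1 ∧ yMap k m n (FreeAlgebra.word k w) =
      u • (w.map fun a => tY k m n a.1 a.2.1 (a.2.2 + 1)).prod := by
  induction w with
  | nil => exact ⟨1, by simp, by simp⟩
  | cons x w ih =>
    obtain ⟨u, hu, h⟩ := ih
    refine ⟨(-1) ^ glPar m x.1 * u, ?_, ?_⟩
    · rw [mul_mul_mul_comm, hu, ← mul_pow]; simp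
    · rw [FreeAlgebra.word_cons, map_mul, h, yMap_ι, smul_mul_smul_comm, List.map_cons,
        List.prod_cons]

lemma loopF_eq_map (r : ℕ) : loopF k m n r =
    (FreeAlgebra.wordsLT k loopWeight (r + 1)).map (yMap k m n).toLinearMap := by
  rw [loopF, FreeAlgebra.wordsLT]
  refine le_antisymm (Submodule.span_le.2 ?_)
    (Submodule.map_le_iff_le_comap.2 (Submodule.span_le.2 ?_))
  · rintro _ ⟨w, hw, rfl⟩
    obtain ⟨u, hu, h⟩ := yMap_word (k := k) w
    refine ⟨u • FreeAlgebra.word k w, Submodule.smul_mem _ _ (Submodule.subset_span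
      ⟨w, Nat.lt_succ_of_le hw, rfl⟩), ?_⟩
    rw [AlgHom.toLinearMap_apply, map_smul, h, smul_smul, hu, one_smul]
  · rintro _ ⟨w, hw, rfl⟩
    obtain ⟨u, -, h⟩ := yMap_word (k := k) w
    rw [SetLike.mem_coe, Submodule.mem_comap, AlgHom.toLinearMap_apply, h]
    exact Submodule.smul_mem _ _ (Submodule.subset_span ⟨w, Nat.le_of_lt_succ hw, rfl⟩)

lemma mk_uRel_word (w : List (Fin (m + n) × Fin (m + n) × ℕ)) :
    RingQuot.mkAlgHom k (URel k m n) (FreeAlgebra.word k w) = (w.map (EU k m n)).prod := by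
  rw [FreeAlgebra.word, map_list_prod, List.map_map]
  rfl

lemma gradU_eq_map (r : ℕ) : gradU k m n r =
    (FreeAlgebra.wordsEQ k loopWeight r).map (RingQuot.mkAlgHom k (URel k m n)).toLinearMap := by
  rw [gradU, FreeAlgebra.wordsEQ]
  refine le_antisymm (Submodule.span_le.2 ?_)
    (Submodule.map_le_iff_le_comap.2 (Submodule.span_le.2 ?_))
  · rintro _ ⟨w, hw, rfl⟩
    exact ⟨FreeAlgebra.word k w, Submodule.subset_span ⟨w, hw, rfl⟩, mk_uRel_word w⟩
  · rintro _ ⟨w, hw, rfl⟩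
    exact Submodule.subset_span ⟨w, hw, mk_uRel_word w⟩

lemma exists_linearMap_of_ker_le {V Y U : Type*} [AddCommGroup V] [AddCommGroup Y]
    [AddCommGroup U] [Module k V] [Module k Y] [Module k U] (φ : V →ₗ[k] Y) (q : V →ₗ[k] U)
    {W : Submodule k V} {F : Submodule k Y} (hF : F = W.map φ)
    (h : ∀ v ∈ W, φ v = 0 → q v = 0) :
    ∃ s : F →ₗ[k] U, ∀ v ∈ W, ∀ hv : φ v ∈ F, s ⟨φ v, hv⟩ = q v := by
  subst hF
  let ψ : W →ₗ[k] W.map φ := φ.submoduleMap W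
  obtain ⟨g, hg⟩ := ψ.exists_rightInverse_of_surjective
    (LinearMap.range_eq_top.2 (φ.submoduleMap_surjective W))
  refine ⟨q ∘ₗ W.subtype ∘ₗ g, fun v hv hv' => ?_⟩
  have h₁ : φ (g ⟨φ v, hv'⟩ : W) = φ v := congrArg Subtype.val (LinearMap.congr_fun hg _)
  have h₂ := h _ (W.sub_mem (g ⟨φ v, hv'⟩).2 hv) (by rw [map_sub, h₁, sub_self])
  rw [map_sub, sub_eq_zero] at h₂
  exact h₂

/-- The symbol map on the `r`-th piece of the loop filtration. -/
lemma exists_symbol [Infinite k] (r : ℕ) : ∃ s : loopF k m n r →ₗ[k] UEnv k m n,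
    ∀ f ∈ FreeAlgebra.wordsLT k loopWeight (r + 1), ∀ h : yMap k m n f ∈ loopF k m n r,
      s ⟨yMap k m n f, h⟩ =
        RingQuot.mkAlgHom k (URel k m n) (FreeAlgebra.proj k loopWeight r f) := by
  obtain ⟨s, hs⟩ := exists_linearMap_of_ker_le (yMap k m n).toLinearMap
    ((RingQuot.mkAlgHom k (URel k m n)).toLinearMap ∘ₗ FreeAlgebra.proj k loopWeight r)
    (loopF_eq_map (k := k) (m := m) (n := n) r)
    fun f hf h => mk_proj_eq_zero_of_yMap_eq_zero hf h
  exact ⟨s, hs⟩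

lemma iSup_gradU : ⨆ r, gradU k m n r = ⊤ := by
  refine eq_top_iff.2 fun x _ => ?_
  obtain ⟨f, rfl⟩ := RingQuot.mkAlgHom_surjective k (URel k m n) x
  have hf : f ∈ Submodule.span k (Set.range
      (FreeAlgebra.word k (X := Fin (m + n) × Fin (m + n) × ℕ))) := by
    rw [FreeAlgebra.span_range_word]; trivial
  have hle : Submodule.span k (Set.range
      (FreeAlgebra.word k (X := Fin (m + n) × Fin (m + n) × ℕ))) ≤
      (⨆ r, gradU k m n r).comap (RingQuot.mkAlgHom k (URel k m n)).toLinearMap := by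
    rw [Submodule.span_le]
    rintro _ ⟨w, rfl⟩
    exact Submodule.mem_iSup_of_mem _ (Submodule.subset_span ⟨w, rfl, mk_uRel_word w⟩)
  exact hle hf

/-- The algebra map recording the degree in the enveloping algebra as the exponent of a polynomial
variable. -/
noncomputable def gradHom (k : Type*) [Field k] (m n : ℕ) :
    UEnv k m n →ₐ[k] Polynomial (UEnv k m n) :=
  RingQuot.liftAlgHom k ⟨FreeAlgebra.lift k fun a => Polynomial.monomial a.2.2 (EU k m n a), by
    rintro _ _ ⟨a, b⟩
    have h := RingQuot.mkAlgHom_rel k (URel.rel (k := k) (m := m) (n := n) a b)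
    simp only [neg_one_pow_smul_eq_superSign (k := k)] at h ⊢
    have h' := congrArg (Polynomial.monomial (a.2.2 + b.2.2)) h
    simp only [map_sub, map_mul, map_smul, apply_ite (RingQuot.mkAlgHom k (URel k m n)),
      map_zero, apply_ite (Polynomial.monomial (a.2.2 + b.2.2)),
      ← Polynomial.smul_monomial] at h'
    simp only [map_sub, map_mul, map_smul, FreeAlgebra.lift_ι_apply,
      Polynomial.monomial_mul_monomial, add_comm b.2.2,
      apply_ite (FreeAlgebra.lift k fun a => Polynomial.monomial a.2.2 (EU k m n a)), map_zero]
    exact h'⟩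

lemma gradHom_EU (a : Fin (m + n) × Fin (m + n) × ℕ) :
    gradHom k m n (EU k m n a) = Polynomial.monomial a.2.2 (EU k m n a) := by
  rw [gradHom, EU, RingQuot.liftAlgHom_mkAlgHom_apply, FreeAlgebra.lift_ι_apply]
  rfl

lemma gradHom_of_mem_gradU {r : ℕ} {x : UEnv k m n} (hx : x ∈ gradU k m n r) :
    gradHom k m n x = Polynomial.monomial r x := by
  rw [gradU] at hx
  induction hx using Submodule.span_induction with
  | mem x hx =>
    obtain ⟨w, rfl, rfl⟩ := hx
    induction w with
    | nil => simp
    | cons a w ih =>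
      rw [List.map_cons, List.prod_cons, map_mul, ih, gradHom_EU,
        Polynomial.monomial_mul_monomial, List.map_cons, List.sum_cons]
  | zero => simp
  | add x y _ _ hx hy => rw [map_add, hx, hy, map_add]
  | smul c x _ hx => rw [map_smul, hx, Polynomial.smul_monomial]

lemma iSupIndep_gradU : iSupIndep (gradU k m n) := by
  intro r
  rw [Submodule.disjoint_def]
  intro x hx hx'
  have hle : ⨆ (s : ℕ) (_ : s ≠ r), gradU k m n s ≤ LinearMap.ker
      ((Polynomial.lcoeff (UEnv k m n) r).restrictScalars k ∘ₗ (gradHom k m n).toLinearMap) := by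
    refine iSup₂_le fun s hs y hy => ?_
    change (gradHom k m n y).coeff r = 0
    rw [gradHom_of_mem_gradU hy, Polynomial.coeff_monomial, if_neg hs]
  have h : (gradHom k m n x).coeff r = 0 := hle hx'
  rwa [gradHom_of_mem_gradU hx, Polynomial.coeff_monomial, if_pos rfl] at h

end Symbol

/-- the assignment t_{i,j}^{(r)} ↦ (−1)^{|i|} e_{i,j}x^{r−1} defines an
isomorphism of graded superalgebras gr Y_{m|n} ≅ U(gl_{m|n}[x]) for the loop filtration.
This is expressed through a family of symbol maps s_r : F_r Y_{m|n} → U(gl_{m|n}[x])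
(i.e. the components F_r/F_{r−1} ≅ U(g)_r of the isomorphism): each s_r has kernel
F_{r−1}, has image the degree-r component of U(g), the family is multiplicative, sends
the class of t_{i,j}^{(r+1)} to (−1)^{|i|} e_{i,j}x^r, and the degree components of U(g)
are independent and exhaust U(g). -/
theorem gr_Yangian_iso_UEnv (k : Type*) [Field k] [IsAlgClosed k]
    (p : ℕ) [CharP k p] (hp : 0 < p) (m n : ℕ) :
    ∃ s : (r : ℕ) → (loopF k m n r →ₗ[k] UEnv k m n),
      -- kernel of the symbol map at level r is F_{r-1} (and F_{-1} = 0)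
      (Function.Injective (s 0)) ∧
      (∀ (r : ℕ) (x : loopF k m n (r+1)),
        s (r+1) x = 0 ↔ (x : Yangian k m n) ∈ loopF k m n r) ∧
      -- the image of the symbol map at level r is the degree-r component of U(g)
      (∀ r : ℕ, LinearMap.range (s r) = gradU k m n r) ∧
      -- multiplicativity (the map gr Y → U(g) is an algebra map)
      (∀ (h : (1 : Yangian k m n) ∈ loopF k m n 0), s 0 ⟨1, h⟩ = 1) ∧
      (∀ (r r' : ℕ) (x : loopF k m n r) (y : loopF k m n r')
        (h : (x : Yangian k m n) * (y : Yangian k m n) ∈ loopF k m n (r + r')),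
        s (r + r') ⟨(x : Yangian k m n) * (y : Yangian k m n), h⟩ = s r x * s r' y) ∧
      -- the generators are sent as claimed
      (∀ (i j : Fin (m+n)) (r : ℕ) (h : tY k m n i j (r+1) ∈ loopF k m n r),
        s r ⟨tY k m n i j (r+1), h⟩ = ((-1 : ℤ) ^ glPar m i) • EU k m n (i, j, r)) ∧
      -- the degree components of U(g) are independent and exhaust U(g)
      (⨆ r, gradU k m n r) = ⊤ ∧
      iSupIndep (gradU k m n) := by
  choose s hs using fun r => exists_symbol (k := k) (m := m) (n := n) r
  have hmem : ∀ {r : ℕ} {f : FreeAlgebra k (Fin (m + n) × Fin (m + n) × ℕ)},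
      f ∈ FreeAlgebra.wordsLT k loopWeight (r + 1) → yMap k m n f ∈ loopF k m n r := by
    intro r f hf
    rw [loopF_eq_map]
    exact Submodule.mem_map_of_mem hf
  have hlift : ∀ {r : ℕ} (x : loopF k m n r),
      ∃ f ∈ FreeAlgebra.wordsLT k loopWeight (r + 1), yMap k m n f = x := by
    rintro r ⟨x, hx⟩
    rw [loopF_eq_map] at hx
    exact hx
  have hs' : ∀ {r : ℕ} (x : loopF k m n r) {f : FreeAlgebra k (Fin (m + n) × Fin (m + n) × ℕ)},
      f ∈ FreeAlgebra.wordsLT k loopWeight (r + 1) → yMap k m n f = x →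
      s r x = RingQuot.mkAlgHom k (URel k m n) (FreeAlgebra.proj k loopWeight r f) := by
    rintro r ⟨x, hx⟩ f hf rfl
    exact hs r f hf hx
  have hone : (1 : FreeAlgebra k (Fin (m + n) × Fin (m + n) × ℕ)) ∈
      FreeAlgebra.wordsLT k loopWeight (0 + 1) := by
    simpa using FreeAlgebra.word_mem_wordsLT (k := k) (ω := loopWeight (N := m + n)) (l := [])
      (r := 1) (by simp)
  refine ⟨s, ?_, ?_, ?_, ?_, ?_, ?_, iSup_gradU, iSupIndep_gradU⟩
  · intro x y hxy
    obtain ⟨f, hf, hfx⟩ := hlift x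
    obtain ⟨g, hg, hgy⟩ := hlift y
    rw [hs' x hf hfx, hs' y hg hgy, ← sub_eq_zero, ← map_sub, ← map_sub] at hxy
    have h := yMap_mem_of_mk_proj_eq_zero (Submodule.sub_mem _ hf hg) hxy
    rw [FreeAlgebra.wordsLT_zero, Submodule.map_bot, Submodule.mem_bot, map_sub,
      sub_eq_zero, hfx, hgy] at h
    exact Subtype.ext h
  · intro r x
    constructor
    · intro hx
      obtain ⟨f, hf, hfx⟩ := hlift x
      rw [hs' x hf hfx] at hx
      rw [loopF_eq_map, ← hfx]
      exact yMap_mem_of_mk_proj_eq_zero hf hx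
    · intro hx
      rw [loopF_eq_map] at hx
      obtain ⟨f, hf, hfx⟩ := hx
      rw [hs' x (FreeAlgebra.wordsLT_mono _ (Nat.le_succ _) hf) hfx,
        FreeAlgebra.proj_of_mem_wordsLT hf, map_zero]
  · intro r
    rw [gradU_eq_map]
    refine le_antisymm ?_ ?_
    · rintro _ ⟨x, rfl⟩
      obtain ⟨f, hf, hfx⟩ := hlift x
      rw [hs' x hf hfx]
      exact Submodule.mem_map_of_mem (FreeAlgebra.proj_mem_wordsEQ _ _ _)
    · rintro _ ⟨f, hf, rfl⟩
      have hf' := FreeAlgebra.wordsEQ_le_wordsLT _ _ hf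
      refine ⟨⟨yMap k m n f, hmem hf'⟩, ?_⟩
      rw [hs r f hf', FreeAlgebra.proj_of_mem_wordsEQ r hf, if_pos rfl]
      rfl
  · intro h
    rw [hs' ⟨1, h⟩ hone (map_one _), ← FreeAlgebra.word_nil, FreeAlgebra.proj_word,
      FreeAlgebra.weight_nil, if_pos rfl, FreeAlgebra.word_nil, map_one]
  · intro r r' x y h
    obtain ⟨f, hf, hfx⟩ := hlift x
    obtain ⟨g, hg, hgy⟩ := hlift y
    rw [hs' x hf hfx, hs' y hg hgy, hs' ⟨_, h⟩ (FreeAlgebra.mul_mem_wordsLT hf hg)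
      (by rw [map_mul, hfx, hgy]), FreeAlgebra.proj_mul hf hg, map_mul]
  · intro i j r h
    have hι : _ ∈ FreeAlgebra.wordsEQ k loopWeight r :=
      FreeAlgebra.ι_mem_wordsEQ (k := k) loopWeight (i, j, r)
    have hf := Submodule.smul_mem _ ((-1 : k) ^ glPar m i) hι
    rw [hs' ⟨_, h⟩ (FreeAlgebra.wordsEQ_le_wordsLT _ _ hf) (tY_succ_eq i j r).symm,
      FreeAlgebra.proj_of_mem_wordsEQ r hf, if_pos rfl, map_smul]
    exact (neg_one_pow_zsmul (k := k) (glPar m i) (EU k m n (i, j, r))).symm
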